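/- arXiv:0812.2281 — 5 statements merged into one kernel-verified Lean document; each statement's English description precedes it below -/
import Mathlib

section
/- For any real number θ, the set Bad_θ(1,1) := {x ∈ ℝ : ∃ c > 0 such that for all nonzero integers q, ‖θq − x‖_ℤ ≥ c/|q|} is an 1/8-winning set for Schmidt's game on ℝ. -/
/-- `normZ x = ‖x‖_ℤ` is the distance from `x` to the nearest integer. -/
noncomputable def normZ (x : ℝ) : ℝ := ⨅ p : ℤ, |x - (p : ℝ)|

/-- `Bad_θ(1,1)`: the set of `x` such that for some `c > 0`,
`‖θq − x‖_ℤ ≥ c/|q|` for all nonzero integers `q`. -/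
def BadTheta (θ : ℝ) : Set ℝ :=
  {x : ℝ | ∃ c > 0, ∀ q : ℤ, q ≠ 0 → normZ (θ * q - x) ≥ c / |(q : ℝ)|}

/-- A pair `(c, r)` represents the closed ball of center `c` and radius `r` in `ℝ`. -/
def ballOf (B : ℝ × ℝ) : Set ℝ := Metric.closedBall B.1 B.2

/-- `S` is `(α,β)`-winning for Schmidt's game on `ℝ`: White has a strategy `f`
(assigning to each finite history of Black's moves a ball) such that, whenever Black
plays legally (the initial Black ball has positive radius, and each subsequent Black
ball is contained in the previous White ball and has radius `β` times that of the
White ball), White's moves are legal (each White ball is contained in the current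
Black ball and has radius `α` times that of the Black ball) and the intersection of
all the balls lies in `S`. -/
def SchmidtWinning (α β : ℝ) (S : Set ℝ) : Prop :=
  ∃ f : List (ℝ × ℝ) → ℝ × ℝ,
    ∀ B : ℕ → ℝ × ℝ,
      (0 < (B 0).2) →
      (∀ n : ℕ,
        (B (n + 1)).2 = β * (f (List.ofFn (fun i : Fin (n + 1) => B i))).2 ∧
        ballOf (B (n + 1)) ⊆ ballOf (f (List.ofFn (fun i : Fin (n + 1) => B i)))) →
      ((∀ n : ℕ,
        (f (List.ofFn (fun i : Fin (n + 1) => B i))).2 = α * (B n).2 ∧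
        ballOf (f (List.ofFn (fun i : Fin (n + 1) => B i))) ⊆ ballOf (B n)) ∧
        (⋂ n : ℕ, ballOf (B n)) ⊆ S)

/-- `S` is `α`-winning if it is `(α,β)`-winning for every `β` with `0 < β < 1`. -/
def SchmidtAlphaWinning (α : ℝ) (S : Set ℝ) : Prop :=
  ∀ β : ℝ, 0 < β → β < 1 → SchmidtWinning α β S

/-- The least positive integer `q` such that `θ * q` is within `4 * r` of an integer. -/
noncomputable def returnTime (θ r : ℝ) : ℕ :=
  sInf {q : ℕ | 0 < q ∧ ∃ p : ℤ, |θ * q - p| < 4 * r}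

theorem returnTime_mem (θ : ℝ) {r : ℝ} (hr : 0 < r) :
    0 < returnTime θ r ∧ ∃ p : ℤ, |θ * returnTime θ r - p| < 4 * r := by
  refine Nat.sInf_mem (s := {q : ℕ | 0 < q ∧ ∃ p : ℤ, |θ * q - p| < 4 * r}) ?_
  obtain ⟨N, hN⟩ := exists_nat_gt (1 / (4 * r))
  have hN0 : (0 : ℝ) < N := lt_trans (by positivity) hN
  obtain ⟨j, k, hk, -, h⟩ := Real.exists_int_int_abs_mul_sub_le θ (Nat.cast_pos.1 hN0)
  refine ⟨k.toNat, by simpa using hk, j, ?_⟩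
  have hcast : ((k.toNat : ℕ) : ℝ) = k := by
    exact_mod_cast Int.toNat_of_nonneg hk.le
  rw [hcast, mul_comm]
  refine h.trans_lt ?_
  rw [div_lt_iff₀ (by positivity)] at hN ⊢
  nlinarith

theorem returnTime_le {θ r : ℝ} {q : ℕ} (hq : 0 < q) {p : ℤ} (h : |θ * q - p| < 4 * r) :
    returnTime θ r ≤ q :=
  Nat.sInf_le ⟨hq, p, h⟩

theorem le_abs_mul_sub_of_abs_lt_returnTime {θ r : ℝ} {d : ℤ} (hd : d ≠ 0)
    (hlt : |d| < returnTime θ r) (e : ℤ) : 4 * r ≤ |θ * d - e| := by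
  by_contra! h
  obtain ⟨n, rfl | rfl⟩ := Int.eq_nat_or_neg d
  · rw [Nat.abs_cast] at hlt
    refine (Int.ofNat_lt.1 hlt).not_ge (returnTime_le (by omega) (p := e) ?_)
    exact_mod_cast h
  · rw [abs_neg, Nat.abs_cast] at hlt
    refine (Int.ofNat_lt.1 hlt).not_ge (returnTime_le (by omega) (p := -e) ?_)
    refine lt_of_eq_of_lt ?_ h
    rw [← abs_neg]
    congr 1
    push_cast
    ring

/-- White's move: a ball of radius `r / 8` inside `[y - r, y + r]` that stays away from all the
points `θ * s - p` with `s` in the centred window of length `returnTime θ r`. -/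
theorem exists_center_avoiding (θ y : ℝ) {r : ℝ} (hr : 0 < r) :
    ∃ c : ℝ, |c - y| ≤ 7 / 8 * r ∧ (4 * r ≤ 1 → ∀ x : ℝ, |x - c| ≤ 1 / 8 * r → ∀ s p : ℤ,
      -(returnTime θ r : ℤ) < 2 * s → 2 * s ≤ returnTime θ r →
      3 / 4 * r ≤ |θ * s - p - x|) := by
  by_contra! H
  obtain ⟨h1, x, hx, s, p, hs, hs', hp⟩ := H (y + 7 / 8 * r) (by
    rw [add_sub_cancel_left, abs_of_pos (by positivity)])
  obtain ⟨-, x', hx', s', p', ht, ht', hp'⟩ := H (y - 7 / 8 * r) (by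
    rw [sub_sub_cancel_left, abs_neg, abs_of_pos (by positivity)])
  rw [abs_le] at hx hx'
  rw [abs_lt] at hp hp'
  have hpos : 0 < θ * (s - s' : ℤ) - (p - p' : ℤ) := by push_cast; linarith
  have hlt : θ * (s - s' : ℤ) - (p - p' : ℤ) < 4 * r := by push_cast; linarith
  by_cases hd : s - s' = 0
  · rw [hd] at hpos hlt
    have h2 : (0 : ℝ) < ((-(p - p') : ℤ) : ℝ) := by push_cast at hpos ⊢; linarith
    have h3 : ((-(p - p') : ℤ) : ℝ) < ((1 : ℤ) : ℝ) := by push_cast at hlt ⊢; linarith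
    have h4 : 0 < -(p - p') := by exact_mod_cast h2
    have h5 := Int.cast_lt.1 h3
    omega
  · have := le_abs_mul_sub_of_abs_lt_returnTime (θ := θ) (r := r) hd
      (abs_lt.2 ⟨by omega, by omega⟩) (p - p')
    rw [abs_of_pos hpos] at this
    linarith

theorem returnTime_mono_radius {θ r r' : ℝ} (hr : 0 < r) (h : r ≤ r') :
    returnTime θ r' ≤ returnTime θ r := by
  obtain ⟨h0, p, hp⟩ := returnTime_mem θ hr
  exact returnTime_le h0 (hp.trans_le (by linarith))

theorem one_le_mul_returnTime_of_ne {θ r r' : ℝ} (hr : 0 < r) (h : r ≤ r')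
    (hne : returnTime θ r' ≠ returnTime θ r) : 1 ≤ 8 * r' * returnTime θ r := by
  obtain ⟨hb0, p', hp'⟩ := returnTime_mem θ hr
  obtain ⟨ha0, p, hp⟩ := returnTime_mem θ (hr.trans_le h)
  have hlt : returnTime θ r' < returnTime θ r :=
    lt_of_le_of_ne (returnTime_mono_radius hr h) hne
  have hge : 4 * r ≤ |θ * returnTime θ r' - p| := by
    by_contra! hcon
    exact hlt.not_ge (returnTime_le ha0 hcon)
  generalize returnTime θ r' = a at *
  generalize returnTime θ r = b at *
  have ha : (0 : ℝ) < a := by exact_mod_cast ha0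
  have hab : (a : ℝ) < b := by exact_mod_cast hlt
  have hdet : (b * p - a * p' : ℤ) ≠ 0 := by
    intro h0
    have h0' : (b : ℝ) * p - a * p' = 0 := by exact_mod_cast h0
    have heq : (a : ℝ) * |θ * b - p'| = b * |θ * a - p| := by
      rw [← abs_of_pos ha, ← abs_mul, abs_of_pos ha, ← abs_of_pos (ha.trans hab), ← abs_mul,
        abs_of_pos (ha.trans hab)]
      congr 1
      linarith
    nlinarith [abs_nonneg (θ * b - p')]
  have h1 : (1 : ℝ) ≤ |(b : ℝ) * p - a * p'| := by exact_mod_cast Int.one_le_abs hdet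
  have h2 : |(b : ℝ) * p - a * p'| ≤ a * |θ * b - p'| + b * |θ * a - p| := by
    calc |(b : ℝ) * p - a * p'| = |a * (θ * b - p') - b * (θ * a - p)| := by congr 1; ring
      _ ≤ |a * (θ * b - p')| + |b * (θ * a - p)| := abs_sub _ _
      _ = _ := by rw [abs_mul, abs_mul, abs_of_pos ha, abs_of_pos (ha.trans hab)]
  nlinarith [abs_nonneg (θ * b - p')]

theorem exists_centered_remainder {Q : ℤ} (hQ : 0 < Q) (q : ℤ) :
    ∃ s j : ℤ, q = s + j * Q ∧ -Q < 2 * s ∧ 2 * s ≤ Q ∧ |j| * Q ≤ 2 * |q| := by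
  have h1 := Int.mul_ediv_self_le (x := 2 * q + Q - 1) (k := 2 * Q) (by omega)
  have h2 := Int.lt_mul_ediv_self_add (x := 2 * q + Q - 1) (k := 2 * Q) (by omega)
  generalize (2 * q + Q - 1) / (2 * Q) = j at h1 h2
  refine ⟨q - j * Q, j, by ring, by linarith, by linarith, ?_⟩
  rcases lt_trichotomy j 0 with hj | rfl | hj
  · rw [abs_of_neg hj]
    nlinarith [neg_abs_le q]
  · simp
  · rw [abs_of_pos hj]
    nlinarith [le_abs_self q]

theorem mem_badTheta_of_forall_window {θ x ρ : ℝ} {R : ℕ → ℝ} (hρ : 0 < ρ) (hρ1 : ρ < 1)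
    (hR0 : 0 < R 0) (hR : ∀ n, R (n + 1) = ρ * R n)
    (H : ∀ n, ∀ s p : ℤ, -(returnTime θ (R n) : ℤ) < 2 * s → 2 * s ≤ returnTime θ (R n) →
      3 / 4 * R n ≤ |θ * s - p - x|) : x ∈ BadTheta θ := by
  have hpos : ∀ n, 0 < R n := fun n => by
    induction n with
    | zero => exact hR0
    | succ n ih => rw [hR]; positivity
  have hle : ∀ n, R (n + 1) ≤ R n := fun n => by
    rw [hR]; nlinarith [hpos n]
  have hanti : Antitone R := antitone_nat_of_succ_le hle
  have hpow : ∀ n, R n = R 0 * ρ ^ n := fun n => by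
    induction n with
    | zero => simp
    | succ n ih => rw [hR, ih]; ring
  obtain ⟨κ, hκ, hκR, hκρ⟩ : ∃ κ > 0, κ ≤ R 0 ∧ κ ≤ ρ / 8 :=
    ⟨min (R 0) (ρ / 8), by positivity, min_le_left _ _, min_le_right _ _⟩
  have hfirst : ∀ n, ∃ m ≤ n, returnTime θ (R m) = returnTime θ (R n) ∧
      κ ≤ R m * returnTime θ (R m) := fun n => by
    induction n with
    | zero =>
      refine ⟨0, le_rfl, rfl, hκR.trans (le_mul_of_one_le_right hR0.le ?_)⟩
      exact_mod_cast (returnTime_mem θ hR0).1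
    | succ n ih =>
      by_cases heq : returnTime θ (R n) = returnTime θ (R (n + 1))
      · obtain ⟨m, hm, h1, h2⟩ := ih
        exact ⟨m, hm.trans n.le_succ, h1.trans heq, h2⟩
      · refine ⟨n + 1, le_rfl, rfl, hκρ.trans ?_⟩
        have := one_le_mul_returnTime_of_ne (hpos (n + 1)) (hle n) heq
        generalize (returnTime θ (R (n + 1)) : ℝ) = b at *
        rw [hR]
        nlinarith
  refine ⟨min (R 0 / 4) (ρ * κ / 64), by positivity, fun q hq => le_ciInf fun p => ?_⟩
  have hq1 : (1 : ℝ) ≤ |(q : ℝ)| := by exact_mod_cast Int.one_le_abs hq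
  have hq0 : (0 : ℝ) < |(q : ℝ)| := by linarith
  have hex : ∃ n, 16 * R n * |(q : ℝ)| ≤ κ := by
    obtain ⟨n, hn⟩ := exists_pow_lt_of_lt_one
      (show 0 < κ / (16 * R 0 * |(q : ℝ)|) by positivity) hρ1
    refine ⟨n, ?_⟩
    rw [lt_div_iff₀ (by positivity)] at hn
    rw [hpow]
    linarith
  classical
  obtain ⟨n, hn, hmin⟩ : ∃ n, 16 * R n * |(q : ℝ)| ≤ κ ∧
      ∀ k < n, κ < 16 * R k * |(q : ℝ)| :=
    ⟨Nat.find hex, Nat.find_spec hex, fun k hk => not_le.1 (Nat.find_min hex hk)⟩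
  have hlow : min (R 0 / 4) (ρ * κ / 64) ≤ R n / 4 * |(q : ℝ)| := by
    rcases n with _ | k
    · refine (min_le_left _ _).trans ?_
      nlinarith
    · refine (min_le_right _ _).trans ?_
      have := hmin k k.lt_succ_self
      rw [hR]
      nlinarith
  obtain ⟨m, hmn, hQ, hκm⟩ := hfirst n
  obtain ⟨hQ0, p', hp'⟩ := returnTime_mem θ (hpos n)
  have Hm := H m
  rw [← hQ] at hQ0 hp'
  generalize returnTime θ (R m) = Q at *
  obtain ⟨s, j, hqs, hs, hs', hj⟩ := exists_centered_remainder (Int.natCast_pos.2 hQ0) q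
  have hQ0' : (0 : ℝ) < Q := by exact_mod_cast hQ0
  have hj' : |(j : ℝ)| * Q ≤ 2 * |(q : ℝ)| := by exact_mod_cast hj
  have hdrift : |(j : ℝ)| * |θ * Q - p'| ≤ R m / 2 := by
    refine le_of_mul_le_mul_right ?_ hQ0'
    have h1 : |(j : ℝ)| * Q * |θ * Q - p'| ≤ 2 * |(q : ℝ)| * (4 * R n) :=
      mul_le_mul hj' hp'.le (abs_nonneg _) (by positivity)
    linarith
  have hdist := Hm s (p - j * p') hs hs'
  have htri : |θ * s - (p - j * p' : ℤ) - x| ≤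
      |θ * q - x - p| + |(j : ℝ)| * |θ * Q - p'| := by
    rw [← abs_mul]
    refine le_trans (le_of_eq ?_) (abs_sub _ _)
    congr 1
    rw [hqs]
    push_cast
    ring
  rw [div_le_iff₀ hq0]
  refine hlow.trans (mul_le_mul_of_nonneg_right ?_ hq0.le)
  linarith [hanti hmn]

open Classical in
/-- White's positional strategy, as a function of Black's last ball. -/
noncomputable def whiteBall (θ : ℝ) (B : ℝ × ℝ) : ℝ × ℝ :=
  (if h : 0 < B.2 then (exists_center_avoiding θ B.1 h).choose else 0, 1 / 8 * B.2)

theorem whiteBall_spec (θ : ℝ) {B : ℝ × ℝ} (h : 0 < B.2) :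
    |(whiteBall θ B).1 - B.1| ≤ 7 / 8 * B.2 ∧
    (4 * B.2 ≤ 1 → ∀ x : ℝ, |x - (whiteBall θ B).1| ≤ 1 / 8 * B.2 → ∀ s p : ℤ,
      -(returnTime θ B.2 : ℤ) < 2 * s → 2 * s ≤ returnTime θ B.2 →
      3 / 4 * B.2 ≤ |θ * s - p - x|) := by
  simp only [whiteBall, dif_pos h]
  exact (exists_center_avoiding θ B.1 h).choose_spec

/-- For any real number `θ`, `Bad_θ(1,1)` is a `1/8`-winning set. -/
theorem badTheta_is_one_eighth_winning (θ : ℝ) :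
    SchmidtAlphaWinning (1 / 8) (BadTheta θ) := by
  intro β hβ hβ1
  refine ⟨fun L => whiteBall θ (L.getLastD 0), fun B hB0 hB => ?_⟩
  have hlast : ∀ n : ℕ, (List.ofFn (fun i : Fin (n + 1) => B i)).getLastD 0 = B n := fun n => by
    rw [List.ofFn_succ', List.concat_eq_append]
    simp
  simp only [hlast] at hB ⊢
  have hrad : ∀ n, (B (n + 1)).2 = β / 8 * (B n).2 := fun n => by
    rw [(hB n).1]
    simp only [whiteBall]
    ring
  have hpos : ∀ n, 0 < (B n).2 := fun n => by
    induction n with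
    | zero => exact hB0
    | succ n ih => rw [hrad]; positivity
  refine ⟨fun n => ⟨rfl, ?_⟩, fun x hx => ?_⟩
  · refine Metric.closedBall_subset_closedBall' ?_
    rw [Real.dist_eq]
    have := (whiteBall_spec θ (hpos n)).1
    simp only [whiteBall] at this ⊢
    linarith
  · have hpow : ∀ n, (B n).2 = (B 0).2 * (β / 8) ^ n := fun n => by
      induction n with
      | zero => simp
      | succ n ih => rw [hrad, ih]; ring
    have hsmall : ∃ N, ∀ n, 4 * (B (N + n)).2 ≤ 1 := by
      obtain ⟨N, hN⟩ := exists_pow_lt_of_lt_one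
        (show 0 < 1 / (4 * (B 0).2) by positivity) (show β / 8 < 1 by linarith)
      refine ⟨N, fun n => ?_⟩
      have h1 : (β / 8) ^ n ≤ 1 := pow_le_one₀ (by positivity) (by linarith)
      have h2 : 0 < (β / 8) ^ N := by positivity
      rw [lt_div_iff₀ (by positivity)] at hN
      rw [hpow, pow_add]
      have h3 : (β / 8) ^ N * (4 * (B 0).2) * (β / 8) ^ n ≤ 1 :=
        mul_le_one₀ hN.le (by positivity) h1
      linarith
    obtain ⟨N, hN⟩ := hsmall
    refine mem_badTheta_of_forall_window (R := fun n => (B (N + n)).2) (ρ := β / 8)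
      (by positivity) (by linarith) (hpos _) (fun n => hrad (N + n)) (fun n => ?_)
    refine (whiteBall_spec θ (hpos (N + n))).2 (hN n) x ?_
    have hmem := (hB (N + n)).2 (Set.mem_iInter.1 hx (N + n + 1))
    rwa [ballOf, Metric.mem_closedBall, Real.dist_eq] at hmem
end

section
/- For any real number θ, the set Bad_θ(1,1) := {x ∈ ℝ : ∃ c > 0 such that for all nonzero integers q, ‖θq − x‖_ℤ ≥ c/|q|} has Hausdorff dimension 1. -/
open Set in
/-- If a family of points indexed by `ℕ → Fin K` is such that two points whose indices first differ
at `n` are at distance at least `δ / M ^ n`, then its range has dimension at least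
`log K / log M`. -/
theorem le_dimH_range_of_separated {K : ℕ} (hK : 2 ≤ K) {M : ℝ} (hM : 1 < M) {δ : ℝ} (hδ : 0 < δ)
    {F : (ℕ → Fin K) → ℝ}
    (hF : ∀ s t n, (∀ i < n, s i = t i) → s n ≠ t n → δ * (M ^ n)⁻¹ ≤ |F s - F t|) :
    ENNReal.ofReal (Real.log K / Real.log M) ≤ dimH (range F) := by
  have hM0 : 0 < M := by linarith
  have hK1 : (1 : ℝ) < K := by exact_mod_cast hK
  set r : ℝ := Real.log K / Real.log M with hr_def
  have hr : 0 < r := div_pos (Real.log_pos hK1) (Real.log_pos hM)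
  have hMr : M ^ r = K := by
    rw [Real.rpow_def_of_pos hM0, hr_def, mul_div_cancel₀ _ (Real.log_pos hM).ne',
      Real.exp_log (by linarith)]
  have key : ∀ s t, |Real.ofDigits s - Real.ofDigits t| ≤ (δ⁻¹) ^ r * |F s - F t| ^ r := by
    intro s t
    by_cases hst : s = t
    · subst hst
      simp [Real.zero_rpow hr.ne']
    have hex : ∃ n, s n ≠ t n := Function.ne_iff.mp hst
    classical
    have hlt : ∀ i < Nat.find hex, s i = t i := fun i hi => not_not.mp (Nat.find_min hex hi)
    have h1 := hF s t _ hlt (Nat.find_spec hex)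
    have h2 := Real.abs_ofDigits_sub_ofDigits_le hlt
    generalize Nat.find hex = n at h1 h2
    have h3 : (M ^ n)⁻¹ ≤ δ⁻¹ * |F s - F t| := by
      rw [inv_mul_eq_div, le_div_iff₀ hδ]
      linarith
    calc |Real.ofDigits s - Real.ofDigits t| ≤ ((K : ℝ) ^ n)⁻¹ := h2
      _ = ((M ^ n)⁻¹) ^ r := by
        rw [Real.inv_rpow (by positivity), ← Real.rpow_natCast M n, ← Real.rpow_mul hM0.le,
          mul_comm, Real.rpow_mul hM0.le, hMr, Real.rpow_natCast]
      _ ≤ (δ⁻¹ * |F s - F t|) ^ r := by gcongr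
      _ = _ := Real.mul_rpow (by positivity) (abs_nonneg _)
  have hinj : Function.Injective F := by
    intro s t hst
    by_contra hne
    have hex : ∃ n, s n ≠ t n := Function.ne_iff.mp hne
    classical
    have h1 := hF s t _ (fun i hi => not_not.mp (Nat.find_min hex hi)) (Nat.find_spec hex)
    rw [hst, sub_self, abs_zero] at h1
    exact absurd h1 (not_le.mpr (by positivity))
  have : Nonempty (ℕ → Fin K) := ⟨fun _ => ⟨0, by omega⟩⟩
  set g : ℝ → ℝ := Real.ofDigits ∘ Function.invFun F
  have hg : ∀ s, g (F s) = Real.ofDigits s := fun s => by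
    simp [g, Function.leftInverse_invFun hinj s]
  have hold : HolderOnWith (δ⁻¹ ^ r).toNNReal r.toNNReal g (range F) := by
    rintro _ ⟨s, rfl⟩ _ ⟨t, rfl⟩
    rw [hg, hg, edist_dist, edist_dist, Real.dist_eq, Real.dist_eq, Real.coe_toNNReal _ hr.le,
      ENNReal.ofReal_rpow_of_nonneg (abs_nonneg _) hr.le]
    change _ ≤ ENNReal.ofReal _ * _
    rw [← ENNReal.ofReal_mul (by positivity)]
    exact ENNReal.ofReal_le_ofReal (key s t)
  have hdim := hold.dimH_image_le (Real.toNNReal_pos.mpr hr)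
  have hsub : Icc (0 : ℝ) 1 ⊆ g '' range F := by
    intro y hy
    obtain ⟨s, -, hs⟩ := Real.ofDigits_SurjOn (b := K) (by omega) hy
    exact ⟨F s, mem_range_self s, by rw [hg, hs]⟩
  have hone : dimH (Icc (0 : ℝ) 1) = 1 := by
    rw [Real.dimH_of_nonempty_interior (by simp)]
    simp
  have h := (hone.symm.le.trans (dimH_mono hsub)).trans hdim
  rw [ENNReal.le_div_iff_mul_le
    (Or.inl (by simpa using hr)) (Or.inl ENNReal.coe_ne_top), one_mul] at h
  exact h

/-- The left endpoint of the `n`-th interval of the branch `s` of a Cantor-like construction, whose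
intervals of generation `n` have length `(10 * K) ^ (-(n + 1))`. The interval starting at `a` is
cut into `10 * K` pieces, of which every other one is kept, `K` in total, beginning with the one
numbered `b n a`. -/
noncomputable def cantorEndpoint {K : ℕ} (b : ℕ → ℝ → ℕ) (s : ℕ → Fin K) : ℕ → ℝ
  | 0 => 0
  | n + 1 => cantorEndpoint b s n +
      (b n (cantorEndpoint b s n) + 2 * (s n : ℕ)) * ((10 * K : ℝ) ^ (n + 2))⁻¹

theorem cantorEndpoint_congr {K : ℕ} (b : ℕ → ℝ → ℕ) {s t : ℕ → Fin K} {n : ℕ}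
    (h : ∀ i < n, s i = t i) : cantorEndpoint b s n = cantorEndpoint b t n := by
  induction n with
  | zero => rfl
  | succ n ih =>
    simp only [cantorEndpoint]
    rw [ih fun i hi => h i (by omega), h n (by omega)]

open Set in
theorem exists_mem_Icc_cantorEndpoint {K : ℕ} {b : ℕ → ℝ → ℕ} (hb : ∀ n a, b n a + 2 * K ≤ 10 * K)
    (s : ℕ → Fin K) :
    ∃ x, ∀ n, x ∈ Icc (cantorEndpoint b s n)
      (cantorEndpoint b s n + ((10 * K : ℝ) ^ (n + 1))⁻¹) := by
  have hK : 0 < K := Fin.pos (s 0)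
  have hM : (0 : ℝ) < 10 * K := by positivity
  have hmono : Monotone (cantorEndpoint b s) := monotone_nat_of_le_succ fun n => by
    simp only [cantorEndpoint]
    linarith [show 0 ≤ (b n (cantorEndpoint b s n) + 2 * (s n : ℕ)) * ((10 * K : ℝ) ^ (n + 2))⁻¹ by
      positivity]
  have hanti : Antitone fun n => cantorEndpoint b s n + ((10 * K : ℝ) ^ (n + 1))⁻¹ :=
    antitone_nat_of_succ_le fun n => by
      simp only [cantorEndpoint]
      have h1 : (b n (cantorEndpoint b s n) + 2 * (s n : ℕ) + 1 : ℝ) ≤ 10 * K := by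
        have := hb n (cantorEndpoint b s n)
        have := (s n).isLt
        exact_mod_cast (by omega : b n (cantorEndpoint b s n) + 2 * (s n : ℕ) + 1 ≤ 10 * K)
      have h2 : ((10 * K : ℝ) ^ (n + 1))⁻¹ = 10 * K * ((10 * K : ℝ) ^ (n + 2))⁻¹ := by
        rw [pow_succ _ (n + 1)]
        field_simp
      have h3 := mul_le_mul_of_nonneg_right h1
        (show 0 ≤ ((10 * K : ℝ) ^ (n + 2))⁻¹ by positivity)
      rw [h2]
      linarith
  have h := hmono.ciSup_mem_iInter_Icc_of_antitone hanti fun n => by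
    simp only [le_add_iff_nonneg_right]
    positivity
  exact ⟨_, fun n => mem_iInter.mp h n⟩

theorem cantorEndpoint_separated {K : ℕ} {b : ℕ → ℝ → ℕ} {s t : ℕ → Fin K} {n : ℕ}
    (hlt : ∀ i < n, s i = t i) (hst : s n < t n) {x y : ℝ}
    (hx : x ≤ cantorEndpoint b s (n + 1) + ((10 * K : ℝ) ^ (n + 2))⁻¹)
    (hy : cantorEndpoint b t (n + 1) ≤ y) :
    ((10 * K : ℝ) ^ (n + 2))⁻¹ ≤ y - x := by
  simp only [cantorEndpoint] at hx hy
  rw [← cantorEndpoint_congr b hlt] at hy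
  have h1 : ((s n : ℕ) : ℝ) + 1 ≤ (t n : ℕ) := by exact_mod_cast hst
  have h2 := mul_le_mul_of_nonneg_right h1
    (show 0 ≤ ((10 * K : ℝ) ^ (n + 2))⁻¹ by positivity)
  linarith

/-- An interval of length `l ≤ 1`, cut into `10 * K` pieces of length `η`, contains a block of
`2 * K` consecutive pieces at distance at least `η` from the integers. -/
theorem exists_block_far_from_int {K : ℕ} (hK : 2 ≤ K) {A l η : ℝ} (hη : 0 < η) (hl : l ≤ 1)
    (h : l = 10 * K * η) :
    ∃ e : ℕ, e + 2 * K ≤ 10 * K ∧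
      ∀ y, A + e * η ≤ y → y ≤ A + (e + 2 * K) * η → ∀ p : ℤ, η ≤ |y - p| := by
  have hK' : (2 : ℝ) ≤ K := by exact_mod_cast hK
  have hKη : 2 * η ≤ K * η := by gcongr
  by_contra! hcon
  obtain ⟨y, hy1, hy2, p, hp⟩ := hcon (2 * K) (by omega)
  obtain ⟨z, hz1, hz2, q, hq⟩ := hcon (6 * K) (by omega)
  push_cast at hy1 hy2 hz1 hz2
  rw [abs_lt] at hp hq
  have h1 : (p : ℝ) < q := by nlinarith
  have h2 : (q : ℝ) < p + 1 := by nlinarith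
  have h3 : p < q := by exact_mod_cast h1
  have h4 : q < p + 1 := by exact_mod_cast h2
  omega

/-- Given integers `m j ∈ [(10 K) ^ j, (10 K) ^ (j + 1)]`, the set of `x` such that all the
`m j * x` are uniformly far from the integers is large. -/
theorem le_dimH_of_forall_far_from_int {K : ℕ} (hK : 2 ≤ K) {m : ℕ → ℕ}
    (hm : ∀ j, (10 * K) ^ j ≤ m j ∧ m j ≤ (10 * K) ^ (j + 1)) :
    ENNReal.ofReal (Real.log K / Real.log (10 * K)) ≤
      dimH {x : ℝ | ∀ (j : ℕ) (p : ℤ), ((10 * K : ℝ) ^ 2)⁻¹ ≤ |m j * x - p|} := by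
  have hK' : (2 : ℝ) ≤ K := by exact_mod_cast hK
  have hM : (0 : ℝ) < 10 * K := by positivity
  have hm1 : ∀ j, (10 * K : ℝ) ^ j ≤ m j := fun j => by exact_mod_cast (hm j).1
  have hm2 : ∀ j, (m j : ℝ) ≤ (10 * K : ℝ) ^ (j + 1) := fun j => by exact_mod_cast (hm j).2
  have hm0 : ∀ j, (0 : ℝ) < m j := fun j => lt_of_lt_of_le (by positivity) (hm1 j)
  have hblock : ∀ (j : ℕ) (a : ℝ), ∃ e : ℕ, e + 2 * K ≤ 10 * K ∧
      ∀ y, m j * a + e * (m j * ((10 * K : ℝ) ^ (j + 2))⁻¹) ≤ y →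
        y ≤ m j * a + (e + 2 * K) * (m j * ((10 * K : ℝ) ^ (j + 2))⁻¹) →
        ∀ p : ℤ, m j * ((10 * K : ℝ) ^ (j + 2))⁻¹ ≤ |y - p| := by
    intro j a
    have := hm0 j
    refine exists_block_far_from_int (l := m j * ((10 * K : ℝ) ^ (j + 1))⁻¹) hK
      (by positivity) ?_ ?_
    · rw [← div_eq_mul_inv, div_le_one (by positivity)]
      exact hm2 j
    · rw [pow_succ _ (j + 1)]
      field_simp
  choose b hb hfar using hblock
  choose F hF using fun s : ℕ → Fin K => exists_mem_Icc_cantorEndpoint hb s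
  have hsep : ∀ s t n, (∀ i < n, s i = t i) → s n ≠ t n →
      ((10 * K : ℝ) ^ 2)⁻¹ * ((10 * K : ℝ) ^ n)⁻¹ ≤ |F s - F t| := by
    intro s t n hlt hne
    rw [← mul_inv, ← pow_add, add_comm 2 n]
    rcases lt_or_gt_of_ne hne with h | h
    · rw [abs_sub_comm]
      exact (cantorEndpoint_separated hlt h (hF s (n + 1)).2 (hF t (n + 1)).1).trans (le_abs_self _)
    · exact (cantorEndpoint_separated (fun i hi => (hlt i hi).symm) h
        (hF t (n + 1)).2 (hF s (n + 1)).1).trans (le_abs_self _)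
  refine (le_dimH_range_of_separated hK (by linarith) (by positivity) hsep).trans (dimH_mono ?_)
  rintro _ ⟨s, rfl⟩ j p
  have hx := hF s (j + 1)
  simp only [cantorEndpoint, Set.mem_Icc] at hx
  set a := cantorEndpoint b s j
  set u := ((10 * K : ℝ) ^ (j + 2))⁻¹ with hu
  have hu0 : 0 < u := by positivity
  have hs : ((s j : ℕ) : ℝ) + 1 ≤ K := by exact_mod_cast (s j).isLt
  have hs0 : (0 : ℝ) ≤ (s j : ℕ) := by positivity
  have h1 : a + b j a * u ≤ F s := by nlinarith [hx.1]
  have h2 : F s ≤ a + (b j a + 2 * K) * u := by nlinarith [hx.2]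
  have h3 := hfar j a (m j * F s)
    (by linarith [mul_le_mul_of_nonneg_left h1 (hm0 j).le])
    (by linarith [mul_le_mul_of_nonneg_left h2 (hm0 j).le]) p
  refine le_trans ?_ h3
  calc ((10 * K : ℝ) ^ 2)⁻¹ = (10 * K : ℝ) ^ j * u := by
        rw [hu, pow_add]
        field_simp
    _ ≤ m j * u := by gcongr; exact hm1 j

/-- A consequence of Dirichlet's theorem: good denominators `m j` of `θ`, one in each block
`[M ^ j, M ^ (j + 1)]`. -/
theorem exists_lacunary_denominators (θ : ℝ) {M : ℕ} (hM : 2 ≤ M) :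
    ∃ m : ℕ → ℕ, (∀ j, M ^ j ≤ m j ∧ m j ≤ M ^ (j + 1)) ∧
      ∀ k, ∃ j ≤ k, ∃ r : ℤ, |m j * θ - r| ≤ ((M : ℝ) ^ k)⁻¹ := by
  have hmin : ∀ j : ℕ, ∃ n ∈ Finset.Icc (M ^ j) (M ^ (j + 1)),
      ∀ n' ∈ Finset.Icc (M ^ j) (M ^ (j + 1)),
        |n * θ - round (n * θ)| ≤ |n' * θ - round (n' * θ)| := fun j =>
    Finset.exists_min_image _ _ (Finset.nonempty_Icc.mpr (Nat.pow_le_pow_right (by omega) (by omega)))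
  choose m hm hmle using hmin
  refine ⟨m, fun j => Finset.mem_Icc.mp (hm j), fun k => ?_⟩
  have hMk : 0 < M ^ k := by positivity
  obtain ⟨n, hn0, hnk, hn⟩ := Real.exists_nat_abs_mul_sub_round_le θ hMk
  refine ⟨Nat.log M n, ?_, round (m (Nat.log M n) * θ), ?_⟩
  · calc Nat.log M n ≤ Nat.log M (M ^ k) := Nat.log_mono_right hnk
      _ = k := Nat.log_pow (by omega) k
  · refine (hmle _ n (Finset.mem_Icc.mpr
      ⟨Nat.pow_log_le_self M hn0.ne', (Nat.lt_pow_succ_log_self (by omega) n).le⟩)).trans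
      (hn.trans ?_)
    rw [one_div]
    push_cast
    gcongr
    linarith

theorem mem_badTheta_of_forall_far_from_int {θ x c : ℝ} {M : ℕ} (hM : 2 ≤ M) (hc : 0 < c)
    (hc1 : c ≤ 1) {m : ℕ → ℕ} (hm : ∀ j, M ^ j ≤ m j ∧ m j ≤ M ^ (j + 1))
    (hθ : ∀ k, ∃ j ≤ k, ∃ r : ℤ, |m j * θ - r| ≤ ((M : ℝ) ^ k)⁻¹)
    (hx : ∀ (j : ℕ) (p : ℤ), c ≤ |m j * x - p|) : x ∈ BadTheta θ := by
  have hM' : (2 : ℝ) ≤ M := by exact_mod_cast hM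
  refine ⟨c ^ 2 / (4 * (M : ℝ) ^ 2), by positivity, fun q hq => le_ciInf fun p => ?_⟩
  have hq1 : (1 : ℝ) ≤ |(q : ℝ)| := by exact_mod_cast Int.one_le_abs hq
  have hex : ∃ k : ℕ, |(q : ℝ)| ≤ c / 2 * (M : ℝ) ^ k := by
    obtain ⟨k, hk⟩ := pow_unbounded_of_one_lt (|(q : ℝ)| / (c / 2)) (by linarith : (1 : ℝ) < M)
    refine ⟨k, ?_⟩
    rw [div_lt_iff₀ (by positivity)] at hk
    linarith
  classical
  obtain ⟨k, hk, hkmin⟩ : ∃ k : ℕ, |(q : ℝ)| ≤ c / 2 * (M : ℝ) ^ (k + 1) ∧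
      c / 2 * (M : ℝ) ^ k < |(q : ℝ)| := by
    have h0 := Nat.find_spec hex
    have hmin := fun i => Nat.find_min hex (m := i)
    rcases hf : Nat.find hex with _ | k
    · rw [hf] at h0
      norm_num at h0
      linarith
    · exact ⟨k, hf ▸ h0, not_le.mp (hmin k (by omega))⟩
  obtain ⟨j, hjk, r, hr⟩ := hθ (k + 1)
  have hmj : (m j : ℝ) ≤ (M : ℝ) ^ (k + 2) := by
    exact_mod_cast (hm j).2.trans (Nat.pow_le_pow_right (by omega) (by omega))
  have h1 : |(q : ℝ) * (m j * θ - r)| ≤ c / 2 := by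
    rw [abs_mul]
    calc |(q : ℝ)| * |m j * θ - r| ≤ c / 2 * (M : ℝ) ^ (k + 1) * ((M : ℝ) ^ (k + 1))⁻¹ := by gcongr
      _ = c / 2 := by field_simp
  have h2 := hx j (q * r - m j * p)
  push_cast at h2
  have h3 : m j * x - (q * r - m j * p) = q * (m j * θ - r) - m j * (θ * q - x - p) := by ring
  rw [h3] at h2
  have h4 := h2.trans (abs_sub _ _)
  rw [abs_mul (m j : ℝ), Nat.abs_cast] at h4
  have h5 : c / 2 ≤ (M : ℝ) ^ (k + 2) * |θ * q - x - p| := by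
    have := mul_le_mul_of_nonneg_right hmj (abs_nonneg (θ * q - x - p))
    linarith
  rw [div_div, div_le_iff₀ (by positivity)]
  have h6 := mul_le_mul_of_nonneg_right hkmin.le (abs_nonneg (θ * q - x - p))
  calc c ^ 2 = 2 * c * (c / 2) := by ring
    _ ≤ 2 * c * ((M : ℝ) ^ (k + 2) * |θ * q - x - p|) := by gcongr
    _ = 4 * (M : ℝ) ^ 2 * (c / 2 * (M : ℝ) ^ k * |θ * q - x - p|) := by ring
    _ ≤ 4 * (M : ℝ) ^ 2 * (|(q : ℝ)| * |θ * q - x - p|) := by gcongr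
    _ = _ := by ring

open Filter Topology in
theorem tendsto_log_div_log_const_mul {C : ℝ} (hC : 0 < C) :
    Tendsto (fun K : ℕ => Real.log K / Real.log (C * K)) atTop (𝓝 1) := by
  have hlog : Tendsto (fun K : ℕ => Real.log K) atTop atTop :=
    Real.tendsto_log_atTop.comp tendsto_natCast_atTop_atTop
  have h1 : Tendsto (fun K : ℕ => (Real.log C / Real.log K + 1)⁻¹) atTop (𝓝 1) := by
    simpa using ((hlog.const_div_atTop (Real.log C)).add_const 1).inv₀ (by norm_num)
  refine h1.congr' ?_
  filter_upwards [eventually_ge_atTop 2] with K hK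
  have hK1 : (1 : ℝ) < K := by exact_mod_cast hK
  have := Real.log_pos hK1
  rw [Real.log_mul hC.ne' (by linarith), div_add_one this.ne', inv_div]

/-- For any real number `θ`, `Bad_θ(1,1)` has Hausdorff dimension `1`. -/
theorem badTheta_dimH_eq_one (θ : ℝ) : dimH (BadTheta θ) = 1 := by
  refine le_antisymm ((dimH_mono (Set.subset_univ _)).trans Real.dimH_univ.le) ?_
  have hlim := ENNReal.tendsto_ofReal (tendsto_log_div_log_const_mul (C := 10) (by norm_num))
  rw [ENNReal.ofReal_one] at hlim
  refine le_of_tendsto hlim ?_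
  filter_upwards [Filter.eventually_ge_atTop 2] with K hK
  obtain ⟨m, hm, hθ⟩ := exists_lacunary_denominators θ (by omega : 2 ≤ 10 * K)
  have hK' : (2 : ℝ) ≤ K := by exact_mod_cast hK
  refine (le_dimH_of_forall_far_from_int hK hm).trans (dimH_mono fun x hx => ?_)
  exact mem_badTheta_of_forall_far_from_int (by omega) (by positivity)
    (inv_le_one_of_one_le₀ (one_le_pow₀ (by linarith))) hm hθ hx
end

section
/- For any countable set {θ_n : n ∈ ℕ} of real numbers and any countable family {f_m : m ∈ ℕ} of invertible affine maps ℝ → ℝ (i.e., maps x ↦ a_m·x + b_m with a_m ≠ 0), the set ⋂_{m ∈ ℕ} ⋂_{n ∈ ℕ} f_m(Bad_{θ_n}(1,1)) has Hausdorff dimension 1. -/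
/-- The strictly increasing enumeration of the digits outside `{j - 1, j, j + 1}`. -/
def skipDigit (j : ℤ) (d : ℕ) : ℕ := if (d : ℤ) + 1 < j then d else d + 3

lemma skipDigit_strictMono (j : ℤ) : StrictMono (skipDigit j) := by
  intro d e h
  unfold skipDigit
  split_ifs <;> omega

lemma skipDigit_lt {j : ℤ} {d S : ℕ} (h : d < S) : skipDigit j d < S + 3 := by
  unfold skipDigit
  split_ifs <;> omega

lemma one_lt_abs_skipDigit_sub (j : ℤ) (d : ℕ) : 1 < |(skipDigit j d : ℤ) - j| := by
  unfold skipDigit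
  rw [lt_abs]
  split_ifs <;> push_cast <;> omega

/-- The address, in base `S + 3`, of the interval of generation `t` of a Cantor set numbered `E`,
when the interval with address `m` loses the children with digits `j t m - 1, j t m, j t m + 1`. -/
def cantorAddress (S : ℕ) (j : ℕ → ℕ → ℤ) : ℕ → ℕ → ℕ
  | 0, E => E
  | t + 1, E => (S + 3) * cantorAddress S j t (E / S) +
      skipDigit (j t (cantorAddress S j t (E / S))) (E % S)

lemma cantorAddress_strictMono {S : ℕ} (hS : 0 < S) (j : ℕ → ℕ → ℤ) (t : ℕ) :
    StrictMono (cantorAddress S j t) := by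
  induction t with
  | zero => exact fun _ _ h => h
  | succ t ih =>
    intro E F h
    simp only [cantorAddress]
    rcases (Nat.div_le_div_right h.le : E / S ≤ F / S).lt_or_eq with hlt | heq
    · have h1 := ih hlt
      have h2 := skipDigit_lt (j := j t (cantorAddress S j t (E / S))) (Nat.mod_lt E hS)
      nlinarith
    · rw [heq]
      have h3 : E % S < F % S := by
        have h4 := Nat.div_add_mod E S
        have h5 := Nat.div_add_mod F S
        rw [heq] at h4
        omega
      have := skipDigit_strictMono (j t (cantorAddress S j t (F / S))) h3
      omega

lemma StrictMono.abs_sub_le_abs_sub {f : ℕ → ℕ} (hf : StrictMono f) (m n : ℕ) :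
    |(m : ℝ) - n| ≤ |(f m : ℝ) - f n| := by
  wlog h : m ≤ n generalizing m n
  · rw [abs_sub_comm, abs_sub_comm (f m : ℝ)]
    exact this n m (by omega)
  obtain ⟨k, rfl⟩ := Nat.exists_eq_add_of_le h
  have h1 : f m + k ≤ f (m + k) := by
    clear h
    induction k with
    | zero => simp
    | succ k ih =>
      have := hf (show m + k < m + (k + 1) by omega)
      omega
  have h2 : (f m : ℝ) + k ≤ f (m + k) := by exact_mod_cast h1
  have h3 : (0 : ℝ) ≤ k := by positivity
  push_cast
  rw [abs_sub_comm, abs_sub_comm (f m : ℝ), abs_of_nonneg (by linarith),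
    abs_of_nonneg (by linarith)]
  linarith

/-- A point in every interval of a nested sequence of closed `R`-adic intervals. -/
lemma exists_mem_nested_adic {R : ℝ} (hR : 0 < R) (m : ℕ → ℝ)
    (h0 : ∀ t, R * m t ≤ m (t + 1)) (h1 : ∀ t, m (t + 1) + 1 ≤ R * (m t + 1)) :
    ∃ x : ℝ, ∀ t, m t / R ^ t ≤ x ∧ x ≤ (m t + 1) / R ^ t := by
  have hmono : Monotone fun t => m t / R ^ t := by
    refine monotone_nat_of_le_succ fun t => ?_
    rw [div_le_div_iff₀ (by positivity) (by positivity), pow_succ]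
    nlinarith [h0 t, pow_pos hR t]
  have hanti : Antitone fun t => (m t + 1) / R ^ t := by
    refine antitone_nat_of_succ_le fun t => ?_
    rw [div_le_div_iff₀ (by positivity) (by positivity), pow_succ]
    nlinarith [h1 t, pow_pos hR t]
  have := hmono.ciSup_mem_iInter_Icc_of_antitone hanti
    (fun t => by simp only; gcongr; linarith)
  exact ⟨_, fun t => Set.mem_iInter.1 this t⟩

/-- Every interval of length `R⁻ᵗ` meets the `R⁻ᵗ⁻¹`-neighbourhood of a `2R⁻ᵗ`-separated set
in at most three consecutive intervals of the next generation. -/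
lemma exists_removed_digit {R : ℕ} (hR : 3 ≤ R) {t : ℕ} {P : Set ℝ}
    (hP : ∀ x ∈ P, ∀ y ∈ P, x ≠ y → 2 / (R : ℝ) ^ t ≤ |x - y|) (m : ℕ) :
    ∃ j : ℤ, ∀ d : ℕ, d < R → 1 < |(d : ℤ) - j| → ∀ x : ℝ,
      ((R * m + d : ℕ) : ℝ) / (R : ℝ) ^ (t + 1) ≤ x →
      x ≤ (((R * m + d : ℕ) : ℝ) + 1) / (R : ℝ) ^ (t + 1) →
      ∀ p ∈ P, 1 / (R : ℝ) ^ (t + 1) ≤ |x - p| := by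
  have hR' : (3 : ℝ) ≤ R := by exact_mod_cast hR
  have hpos : (0 : ℝ) < (R : ℝ) ^ t := by positivity
  have key : ∀ (p x : ℝ) (d : ℕ), ((R * m + d : ℕ) : ℝ) / (R : ℝ) ^ (t + 1) ≤ x →
      x ≤ (((R * m + d : ℕ) : ℝ) + 1) / (R : ℝ) ^ (t + 1) →
      |x - p| < 1 / (R : ℝ) ^ (t + 1) →
      ((R * m + d : ℕ) : ℝ) - 1 < p * (R : ℝ) ^ (t + 1) ∧
        p * (R : ℝ) ^ (t + 1) < ((R * m + d : ℕ) : ℝ) + 2 := by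
    intro p x d h1 h2 h3
    have hp1 : (0 : ℝ) < (R : ℝ) ^ (t + 1) := by positivity
    rw [div_le_iff₀ hp1] at h1
    rw [le_div_iff₀ hp1] at h2
    rw [lt_div_iff₀ hp1] at h3
    have h4 : |(x - p) * (R : ℝ) ^ (t + 1)| < 1 := by
      rwa [abs_mul, abs_of_pos hp1]
    rw [abs_lt] at h4
    constructor <;> linarith
  by_cases hex : ∃ p ∈ P, ∃ d : ℕ, d < R ∧ ∃ x : ℝ,
      ((R * m + d : ℕ) : ℝ) / (R : ℝ) ^ (t + 1) ≤ x ∧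
      x ≤ (((R * m + d : ℕ) : ℝ) + 1) / (R : ℝ) ^ (t + 1) ∧
      |x - p| < 1 / (R : ℝ) ^ (t + 1)
  · obtain ⟨p, hp, d, hd, x, h1, h2, h3⟩ := hex
    obtain ⟨k1, k2⟩ := key p x d h1 h2 h3
    refine ⟨⌊p * (R : ℝ) ^ (t + 1)⌋ - R * m, ?_⟩
    intro e he hej y g1 g2 p' hp'
    by_contra! hcon
    obtain ⟨l1, l2⟩ := key p' y e g1 g2 hcon
    have hd' : (d : ℝ) + 1 ≤ R := by exact_mod_cast hd
    have he' : (e : ℝ) + 1 ≤ R := by exact_mod_cast he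
    have hd0 : (0 : ℝ) ≤ d := by positivity
    have he0 : (0 : ℝ) ≤ e := by positivity
    have hpp : p = p' := by
      by_contra hne
      have hsep := hP p hp p' hp' hne
      rw [div_le_iff₀ hpos] at hsep
      have : 2 * (R : ℝ) ≤ |(p - p') * (R : ℝ) ^ (t + 1)| := by
        rw [abs_mul, abs_of_pos (by positivity : (0 : ℝ) < (R : ℝ) ^ (t + 1)), pow_succ]
        nlinarith
      push_cast at k1 k2 l1 l2
      rcases le_abs.1 this with h | h <;> nlinarith
    subst hpp
    have f1 : ((R * m + e : ℕ) : ℤ) - 1 ≤ ⌊p * (R : ℝ) ^ (t + 1)⌋ := by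
      rw [Int.le_floor]; push_cast at l1 ⊢; linarith
    have f2 : ⌊p * (R : ℝ) ^ (t + 1)⌋ < ((R * m + e : ℕ) : ℤ) + 2 := by
      rw [Int.floor_lt]; push_cast at l2 ⊢; linarith
    push_cast at f1 f2
    rw [lt_abs] at hej
    omega
  · refine ⟨0, fun d hd _ x h1 h2 p hp => ?_⟩
    by_contra! h
    exact hex ⟨p, hp, d, hd, x, h1, h2, h⟩

/-- A parametrisation, with a controlled inverse, of a set of points staying away from a
sequence of separated sets. -/
lemma exists_param_avoiding {S : ℕ} (hS : 0 < S) {P : ℕ → Set ℝ}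
    (hP : ∀ t, ∀ x ∈ P t, ∀ y ∈ P t, x ≠ y → 2 / ((S + 3 : ℕ) : ℝ) ^ t ≤ |x - y|) :
    ∃ g : ℝ → ℝ,
      (∀ y t, ∀ p ∈ P t, 1 / ((S + 3 : ℕ) : ℝ) ^ (t + 1) ≤ |g y - p|) ∧
      ∀ y ∈ Set.Icc (0 : ℝ) 1, ∀ z ∈ Set.Icc (0 : ℝ) 1, ∀ k : ℕ,
        |g y - g z| ≤ 1 / ((S + 3 : ℕ) : ℝ) ^ k → |y - z| ≤ 3 / (S : ℝ) ^ k := by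
  choose j hj using fun t m => exists_removed_digit (R := S + 3) (by omega) (hP t) m
  have hR : (0 : ℝ) < ((S + 3 : ℕ) : ℝ) := by positivity
  have hSr : (0 : ℝ) < (S : ℝ) := by exact_mod_cast hS
  set Φ := cantorAddress S j
  have hdiv : ∀ (y : ℝ) (t : ℕ), ⌊y * (S : ℝ) ^ (t + 1)⌋₊ / S = ⌊y * (S : ℝ) ^ t⌋₊ := by
    intro y t
    rw [← Nat.floor_div_natCast, pow_succ, ← mul_assoc, mul_div_assoc, div_self hSr.ne', mul_one]
  have hstep : ∀ (y : ℝ) (t : ℕ), ∃ d : ℕ, d < S + 3 ∧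
      1 < |(d : ℤ) - j t (Φ t ⌊y * (S : ℝ) ^ t⌋₊)| ∧
      Φ (t + 1) ⌊y * (S : ℝ) ^ (t + 1)⌋₊ = (S + 3) * Φ t ⌊y * (S : ℝ) ^ t⌋₊ + d := by
    intro y t
    refine ⟨skipDigit (j t (Φ t ⌊y * (S : ℝ) ^ t⌋₊)) (⌊y * (S : ℝ) ^ (t + 1)⌋₊ % S),
      skipDigit_lt (Nat.mod_lt _ hS), one_lt_abs_skipDigit_sub _ _, ?_⟩
    rw [← hdiv y t]
    rfl
  have hg : ∀ y : ℝ, ∃ x : ℝ, ∀ t : ℕ,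
      (Φ t ⌊y * (S : ℝ) ^ t⌋₊ : ℝ) / ((S + 3 : ℕ) : ℝ) ^ t ≤ x ∧
      x ≤ ((Φ t ⌊y * (S : ℝ) ^ t⌋₊ : ℝ) + 1) / ((S + 3 : ℕ) : ℝ) ^ t := by
    intro y
    refine exists_mem_nested_adic hR (fun t => (Φ t ⌊y * (S : ℝ) ^ t⌋₊ : ℝ)) ?_ ?_ <;> intro t <;>
      obtain ⟨d, hd, -, he⟩ := hstep y t <;> simp only [he]
    · push_cast
      have : (0 : ℝ) ≤ d := by positivity
      linarith
    · have : (d : ℝ) + 1 ≤ ((S + 3 : ℕ) : ℝ) := by exact_mod_cast hd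
      push_cast at this ⊢
      linarith
  choose g hg using hg
  refine ⟨g, fun y t p hp => ?_, fun y hy z hz k hk => ?_⟩
  · obtain ⟨d, hd, hdj, he⟩ := hstep y t
    have h := hg y (t + 1)
    rw [he] at h
    exact hj t _ d hd hdj _ h.1 h.2 p hp
  · have hSk : (0 : ℝ) < (S : ℝ) ^ k := by positivity
    have hRk : (0 : ℝ) < ((S + 3 : ℕ) : ℝ) ^ k := by positivity
    obtain ⟨y1, y2⟩ := hg y k
    obtain ⟨z1, z2⟩ := hg z k
    rw [div_le_iff₀ hRk] at y1 z1
    rw [le_div_iff₀ hRk] at y2 z2 hk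
    have hk' : |(g y - g z) * ((S + 3 : ℕ) : ℝ) ^ k| ≤ 1 := by rwa [abs_mul, abs_of_pos hRk]
    rw [abs_le] at hk'
    have h2 : |(Φ k ⌊y * (S : ℝ) ^ k⌋₊ : ℝ) - Φ k ⌊z * (S : ℝ) ^ k⌋₊| ≤ 2 := by
      rw [abs_le]; constructor <;> linarith
    have h3 := ((cantorAddress_strictMono hS j k).abs_sub_le_abs_sub
      ⌊y * (S : ℝ) ^ k⌋₊ ⌊z * (S : ℝ) ^ k⌋₊).trans h2
    have a1 := Nat.floor_le (mul_nonneg hy.1 hSk.le)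
    have a2 := Nat.lt_floor_add_one (y * (S : ℝ) ^ k)
    have b1 := Nat.floor_le (mul_nonneg hz.1 hSk.le)
    have b2 := Nat.lt_floor_add_one (z * (S : ℝ) ^ k)
    have h4 : |(y - z) * (S : ℝ) ^ k| ≤ 3 := by
      rw [abs_le] at h3 ⊢
      constructor <;> linarith
    rwa [abs_mul, abs_of_pos hSk, ← le_div_iff₀ hSk] at h4

/-- A set admitting a parametrisation by `[0, 1]` with a Hölder inverse of exponent `r` has
dimension at least `r`. -/
lemma le_dimH_of_param {A : Set ℝ} {g : ℝ → ℝ} {R S r : ℝ} (hR : 1 < R) (hS : 1 < S) (hr : 0 < r)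
    (hRS : R ^ r ≤ S) (hgA : ∀ y, g y ∈ A)
    (hg : ∀ y ∈ Set.Icc (0 : ℝ) 1, ∀ z ∈ Set.Icc (0 : ℝ) 1, ∀ k : ℕ,
        |g y - g z| ≤ 1 / R ^ k → |y - z| ≤ 3 / S ^ k) :
    ENNReal.ofReal r ≤ dimH A := by
  have hR0 : 0 < R := by linarith
  have hS0 : 0 < S := by linarith
  have hbound : ∀ y ∈ Set.Icc (0 : ℝ) 1, ∀ z ∈ Set.Icc (0 : ℝ) 1,
      |y - z| ≤ 3 * S * |g y - g z| ^ r := by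
    intro y hy z hz
    rcases eq_or_lt_of_le (abs_nonneg (g y - g z)) with h0 | h0
    · have hz : |y - z| ≤ 0 := by
        have hlim : Filter.Tendsto (fun k : ℕ => 3 / S ^ k) Filter.atTop (nhds 0) := by
          refine Filter.Tendsto.div_atTop tendsto_const_nhds (tendsto_pow_atTop_atTop_of_one_lt hS)
        exact ge_of_tendsto' hlim fun k => hg y hy z hz k (by rw [← h0]; positivity)
      rw [← h0, Real.zero_rpow hr.ne']
      linarith
    rcases le_or_gt 1 |g y - g z| with h1 | h1
    · have : |y - z| ≤ 1 := by
        rw [abs_le]; constructor <;> linarith [hy.1, hy.2, hz.1, hz.2]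
      have h2 : 1 ≤ |g y - g z| ^ r := Real.one_le_rpow h1 hr.le
      nlinarith
    · obtain ⟨k, hk1, hk2⟩ := exists_nat_pow_near ((one_le_inv₀ h0).2 h1.le) hR
      have h3 := hg y hy z hz k (by
        rw [one_div]; exact (le_inv_comm₀ (by positivity) h0).1 hk1)
      have h4 : 1 / S ^ (k + 1) ≤ |g y - g z| ^ r := by
        have h5 : (R ^ (k + 1))⁻¹ ≤ |g y - g z| := by
          exact (inv_lt_comm₀ h0 (by positivity)).1 hk2 |>.le
        calc 1 / S ^ (k + 1) ≤ 1 / (R ^ r) ^ (k + 1) := by gcongr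
          _ = ((R ^ (k + 1))⁻¹) ^ r := by
            rw [Real.inv_rpow (by positivity), one_div, ← Real.rpow_natCast, ← Real.rpow_natCast,
              ← Real.rpow_mul hR0.le, ← Real.rpow_mul hR0.le, mul_comm]
          _ ≤ _ := by gcongr
      calc |y - z| ≤ 3 / S ^ k := h3
        _ = 3 * S * (1 / S ^ (k + 1)) := by rw [pow_succ]; field_simp
        _ ≤ _ := by gcongr
  have hinj : Set.InjOn g (Set.Icc 0 1) := by
    intro y hy z hz h
    have := hbound y hy z hz
    rw [h, sub_self, abs_zero, Real.zero_rpow hr.ne', mul_zero] at this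
    exact sub_eq_zero.1 (abs_nonpos_iff.1 this)
  have hleft := hinj.leftInvOn_invFunOn
  have hhol : HolderOnWith (Real.toNNReal (3 * S)) (Real.toNNReal r)
      (Function.invFunOn g (Set.Icc 0 1)) (g '' Set.Icc 0 1) := by
    rintro _ ⟨y, hy, rfl⟩ _ ⟨z, hz, rfl⟩
    rw [hleft hy, hleft hz, edist_dist, edist_dist, Real.dist_eq, Real.dist_eq,
      Real.coe_toNNReal r hr.le, ENNReal.ofReal_rpow_of_nonneg (abs_nonneg _) hr.le]
    change _ ≤ ENNReal.ofReal (3 * S) * _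
    rw [← ENNReal.ofReal_mul (by positivity)]
    exact ENNReal.ofReal_le_ofReal (hbound y hy z hz)
  have hdim := hhol.dimH_image_le (Real.toNNReal_pos.2 hr)
  rw [hleft.image_image, Real.dimH_of_nonempty_interior (by simp)] at hdim
  have hne : ((Real.toNNReal r : NNReal) : ENNReal) ≠ 0 := by simpa using hr
  rw [ENNReal.le_div_iff_mul_le (Or.inl hne) (Or.inl ENNReal.coe_ne_top), Module.finrank_self,
    Nat.cast_one, one_mul] at hdim
  refine hdim.trans (dimH_mono ?_)
  rintro _ ⟨y, -, rfl⟩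
  exact hgA y

/-- The distance from `x` to the nearest integer, attained at `round x`. -/
noncomputable def roundDist (x : ℝ) : ℝ := |x - round x|

lemma roundDist_le (x : ℝ) (p : ℤ) : roundDist x ≤ |x - p| := round_le x p

lemma roundDist_nonneg (x : ℝ) : 0 ≤ roundDist x := abs_nonneg _

/-- `n` is the least positive integer minimising the distance from `jθ` to the integers
among `0 < j ≤ Q`. -/
structure IsBestApprox (θ Q : ℝ) (n : ℕ) : Prop where
  pos : 0 < n
  le : (n : ℝ) ≤ Q
  min : ∀ j : ℕ, 0 < j → (j : ℝ) ≤ Q → roundDist (n * θ) ≤ roundDist (j * θ)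
  lt : ∀ j : ℕ, 0 < j → j < n → roundDist (n * θ) < roundDist (j * θ)

lemma exists_isBestApprox (θ : ℝ) {Q : ℝ} (hQ : 1 ≤ Q) : ∃ n, IsBestApprox θ Q n := by
  classical
  have hQ1 : 1 ≤ ⌊Q⌋₊ := Nat.one_le_floor_iff _ |>.2 hQ
  have hex : ∃ n : ℕ, 0 < n ∧ (n : ℝ) ≤ Q ∧
      ∀ j : ℕ, 0 < j → (j : ℝ) ≤ Q → roundDist (n * θ) ≤ roundDist (j * θ) := by
    obtain ⟨n, hn, hmin⟩ := (Finset.Icc 1 ⌊Q⌋₊).exists_min_image (fun n => roundDist (n * θ))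
      ⟨1, by simp [hQ1]⟩
    rw [Finset.mem_Icc, Nat.le_floor_iff (by linarith)] at hn
    refine ⟨n, hn.1, hn.2, fun j hj hjQ => hmin j ?_⟩
    rw [Finset.mem_Icc, Nat.le_floor_iff (by linarith)]
    exact ⟨hj, hjQ⟩
  obtain ⟨h1, h2, h3⟩ := Nat.find_spec hex
  refine ⟨Nat.find hex, h1, h2, h3, fun j hj hjn => ?_⟩
  have hmin := Nat.find_min hex hjn
  push Not at hmin
  obtain ⟨i, hi, hiQ, hij⟩ := hmin hj (le_trans (by exact_mod_cast hjn.le) h2)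
  exact (h3 i hi hiQ).trans_lt hij

namespace IsBestApprox

variable {θ Q : ℝ} {n : ℕ}

lemma restrict (h : IsBestApprox θ Q n) {Q' : ℝ} (hn : (n : ℝ) ≤ Q') (hQ : Q' ≤ Q) :
    IsBestApprox θ Q' n :=
  ⟨h.pos, hn, fun j hj hjQ => h.min j hj (hjQ.trans hQ), h.lt⟩

lemma unique (h : IsBestApprox θ Q n) {m : ℕ} (h' : IsBestApprox θ Q m) : n = m := by
  rcases lt_trichotomy n m with hlt | heq | hlt
  · exact absurd (h'.lt n h.pos hlt) (h.min m h'.pos h'.le).not_gt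
  · exact heq
  · exact absurd (h.lt m h'.pos hlt) (h'.min n h.pos h.le).not_gt

lemma roundDist_le_inv (h : IsBestApprox θ Q n) : roundDist (n * θ) ≤ 1 / Q := by
  have hn : (1 : ℝ) ≤ n := by exact_mod_cast h.pos
  have hQ : 1 ≤ Q := hn.trans h.le
  obtain ⟨k, hk0, hk, hd⟩ := Real.exists_nat_abs_mul_sub_round_le θ
    (Nat.floor_pos.2 hQ)
  refine (h.min k hk0 ((Nat.le_floor_iff (by linarith)).1 hk)).trans (hd.trans ?_)
  have := (Nat.lt_floor_add_one Q).le
  gcongr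

/-- The multiples `jθ` with `0 < j < n` are at distance at least `1 / (2n)` from the integers. -/
lemma inv_le_roundDist (h : IsBestApprox θ Q n) {j : ℕ} (hj : 0 < j) (hjn : j < n) :
    1 / (2 * (n : ℝ)) ≤ roundDist (j * θ) := by
  have hn0 : (0 : ℝ) < n := by exact_mod_cast h.pos
  obtain ⟨m, hm⟩ := exists_isBestApprox θ (Q := ((n - 1 : ℕ) : ℝ))
    (by exact_mod_cast (show 1 ≤ n - 1 by omega))
  have hmn : m < n := by
    have := hm.le
    have : m ≤ n - 1 := by exact_mod_cast this
    omega
  refine le_trans ?_ (hm.min j hj (by exact_mod_cast (show j ≤ n - 1 by omega)))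
  have hlt := h.lt m hm.pos hmn
  have hm0 : (0 : ℝ) < m := by exact_mod_cast hm.pos
  have hmn' : (m : ℝ) < n := by exact_mod_cast hmn
  have hnn := roundDist_nonneg (n * θ)
  have hne : (n : ℤ) * round (m * θ) - m * round (n * θ) ≠ 0 := by
    intro h0
    have h0' : (n : ℝ) * round (m * θ) = m * round (n * θ) := by
      exact_mod_cast sub_eq_zero.1 h0
    have h1 : (n : ℝ) * roundDist (m * θ) = m * roundDist (n * θ) := by
      unfold roundDist
      rw [← abs_of_pos hn0, ← abs_of_pos hm0, ← abs_mul, ← abs_mul, abs_of_pos hn0,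
        abs_of_pos hm0, mul_sub, mul_sub, h0']
      ring_nf
    nlinarith
  have hge : (1 : ℝ) ≤ |(n : ℝ) * round (m * θ) - m * round (n * θ)| := by
    exact_mod_cast Int.one_le_abs hne
  have hle : |(n : ℝ) * round (m * θ) - m * round (n * θ)| ≤
      n * roundDist (m * θ) + m * roundDist (n * θ) := by
    have : (n : ℝ) * round (m * θ) - m * round (n * θ) =
        m * (n * θ - round (n * θ)) - n * (m * θ - round (m * θ)) := by ring
    rw [this]
    refine (abs_sub _ _).trans ?_
    rw [abs_mul, abs_mul, abs_of_pos hn0, abs_of_pos hm0, add_comm]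
    rfl
  rw [div_le_iff₀ (by positivity)]
  nlinarith

end IsBestApprox

/-- The points `qθ - p` with `0 ≤ q < n`, where `n` is the best approximation denominator of `θ`
up to `Q`. -/
def approxPoints (θ Q : ℝ) : Set ℝ :=
  {z | ∃ n, IsBestApprox θ Q n ∧ ∃ q : ℕ, q < n ∧ ∃ p : ℤ, z = q * θ - p}

lemma approxPoints_separated {θ Q : ℝ} {z w : ℝ} (hz : z ∈ approxPoints θ Q)
    (hw : w ∈ approxPoints θ Q) (hzw : z ≠ w) : 1 / (2 * Q) ≤ |z - w| := by
  obtain ⟨n, hn, q, hq, p, rfl⟩ := hz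
  obtain ⟨n', hn', q', hq', p', rfl⟩ := hw
  obtain rfl := hn.unique hn'
  have hn1 : (1 : ℝ) ≤ n := by exact_mod_cast hn.pos
  have hQ : 1 / (2 * Q) ≤ 1 / (2 * (n : ℝ)) := by
    have := hn.le
    gcongr
  refine hQ.trans ?_
  wlog h : q' ≤ q generalizing q q' p p'
  · rw [abs_sub_comm]
    exact this q' hq' p' q p hzw.symm hq (by omega)
  obtain ⟨k, rfl⟩ := Nat.exists_eq_add_of_le h
  rcases Nat.eq_zero_or_pos k with rfl | hk
  · have hpp : p' - p ≠ 0 := by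
      intro h0
      apply hzw
      rw [sub_eq_zero] at h0
      simp [h0]
    have h1 : (1 : ℝ) ≤ |(p' : ℝ) - p| := by exact_mod_cast Int.one_le_abs hpp
    have h2 : ((q' + 0 : ℕ) : ℝ) * θ - p - (q' * θ - p') = p' - p := by push_cast; ring
    rw [h2]
    refine le_trans ?_ h1
    rw [div_le_one (by positivity)]
    linarith
  · refine (hn.inv_le_roundDist hk (by omega)).trans ((roundDist_le _ (p - p')).trans_eq ?_)
    push_cast
    ring_nf

lemma exists_forall_le_of_pos (f : ℕ → ℝ) (N : ℕ) (hf : ∀ q, 0 < q → q ≤ N → 0 < f q) :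
    ∃ c > 0, ∀ q, 0 < q → q ≤ N → c ≤ f q := by
  induction N with
  | zero => exact ⟨1, one_pos, fun q h0 h1 => by omega⟩
  | succ N ih =>
    obtain ⟨c, hc, h⟩ := ih fun q h0 h1 => hf q h0 (by omega)
    refine ⟨Min.min c (f (N + 1)), lt_min hc (hf _ (by omega) le_rfl), fun q h0 h1 => ?_⟩
    rcases h1.lt_or_eq with h2 | rfl
    · exact (min_le_left _ _).trans (h q h0 (by omega))
    · exact min_le_right _ _

/-- Staying away from `approxPoints θ Q` along a geometric sequence of `Q` forces `z` to be badly
approximable by large positive multiples of an irrational `θ`. -/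
lemma exists_forall_large_le_abs {θ z κ K Q₀ : ℝ} (hθ : Irrational θ) (hκ : 0 < κ) (hK : 1 < K)
    (hκK : 2 ≤ κ * K) (hQ₀ : 0 < Q₀)
    (hz : ∀ i : ℕ, ∀ w ∈ approxPoints θ (Q₀ * K ^ i), κ / (Q₀ * K ^ i) ≤ |z - w|) :
    ∃ c > 0, ∃ N : ℕ, ∀ q : ℕ, N < q → ∀ p : ℤ, c / q ≤ |q * θ - z - p| := by
  have hK0 : 0 < K := by linarith
  obtain ⟨δ, hδ, hδ'⟩ := exists_forall_le_of_pos (fun q => roundDist (q * θ)) ⌊Q₀⌋₊ (by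
    intro q hq _
    refine abs_pos.2 (sub_ne_zero.2 ?_)
    exact (hθ.natCast_mul hq.ne').ne_int _)
  refine ⟨κ / (2 * K ^ 3), by positivity, ⌈Max.max Q₀ (1 / δ)⌉₊ + 1, fun q hq p => ?_⟩
  have hqmax : Max.max Q₀ (1 / δ) < q := lt_of_le_of_lt (Nat.le_ceil _) (by
    exact_mod_cast (show ⌈Max.max Q₀ (1 / δ)⌉₊ < q by omega))
  have hqQ : Q₀ < q := (le_max_left _ _).trans_lt hqmax
  have hqδ : 1 / δ < q := (le_max_right _ _).trans_lt hqmax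
  have hq1 : (1 : ℝ) ≤ q := by exact_mod_cast (show 1 ≤ q by omega)
  have hq0 : (0 : ℝ) < q := by linarith
  have hK2 : 1 ≤ K ^ 2 := one_le_pow₀ hK.le
  have hK2q : (q : ℝ) ≤ K ^ 2 * q := le_mul_of_one_le_left hq0.le hK2
  obtain ⟨i, hi1, hi2⟩ := exists_nat_pow_near (x := K ^ 2 * q / Q₀) (y := K)
    (by rw [one_le_div hQ₀]; linarith) hK
  rw [le_div_iff₀ hQ₀] at hi1
  rw [div_lt_iff₀ hQ₀] at hi2
  have hQi : K ^ 2 * q < Q₀ * K ^ (i + 1) := by linarith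
  obtain ⟨n, hn⟩ := exists_isBestApprox θ (Q := Q₀ * K ^ (i + 1)) (by linarith)
  have hn0 : (0 : ℝ) < n := by exact_mod_cast hn.pos
  rcases lt_or_ge q n with hqn | hnq
  · have h1 := hz (i + 1) (q * θ - p) ⟨n, hn, q, hqn, p, rfl⟩
    have h2 : κ / (2 * K ^ 3) / q ≤ κ / (Q₀ * K ^ (i + 1)) := by
      rw [div_div]
      gcongr κ / ?_
      rw [pow_succ K i]
      nlinarith [mul_pos (pow_pos hK0 3) hq0]
    calc _ ≤ _ := h2
      _ ≤ _ := h1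
      _ = _ := by rw [abs_sub_comm]; ring_nf
  · have hnq' : (n : ℝ) ≤ q := by exact_mod_cast hnq
    have hdn : roundDist (n * θ) ≤ 1 / (K ^ 2 * q) :=
      hn.roundDist_le_inv.trans (by gcongr)
    have hnQ : Q₀ ≤ n := by
      by_contra! hlt
      have h1 : δ ≤ roundDist (n * θ) := hδ' n hn.pos (Nat.le_floor hlt.le)
      have h2 : 1 / (K ^ 2 * q) ≤ 1 / q := by gcongr
      have h3 : 1 / (q : ℝ) < δ := by
        rw [div_lt_iff₀ hδ] at hqδ
        rw [div_lt_iff₀ hq0]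
        linarith
      linarith
    obtain ⟨l, hl1, hl2⟩ := exists_nat_pow_near (x := n / Q₀) (y := K)
      (by rw [one_le_div hQ₀]; linarith) hK
    rw [le_div_iff₀ hQ₀] at hl1
    rw [div_lt_iff₀ hQ₀] at hl2
    have hli : l < i + 1 := by
      rw [← pow_lt_pow_iff_right₀ hK]
      nlinarith
    have hbest : IsBestApprox θ (Q₀ * K ^ (l + 1)) n := by
      refine hn.restrict (by linarith) ?_
      gcongr
      · exact hK.le
      · omega
    have h1 := hz (l + 1) ((q % n : ℕ) * θ - (p - ((q / n : ℕ) : ℤ) * round (n * θ) : ℤ))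
      ⟨n, hbest, q % n, Nat.mod_lt _ hn.pos, _, rfl⟩
    have h2 : κ / (K * n) ≤ κ / (Q₀ * K ^ (l + 1)) := by
      gcongr κ / ?_
      rw [pow_succ]
      nlinarith
    have hqdm : (q : ℝ) = n * (q / n : ℕ) + (q % n : ℕ) := by
      exact_mod_cast (Nat.div_add_mod q n).symm
    have h3 : |((q / n : ℕ) : ℝ) * (n * θ - round (n * θ))| ≤ 1 / (K ^ 2 * n) := by
      rw [abs_mul, Nat.abs_cast]
      calc ((q / n : ℕ) : ℝ) * |n * θ - round (n * θ)| ≤ (q / n) * (1 / (K ^ 2 * q)) := by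
            gcongr
            · exact Nat.cast_div_le
            · exact hdn
        _ = 1 / (K ^ 2 * n) := by field_simp
    have h4 : 1 / (K ^ 2 * n) ≤ κ / (K * n) / 2 := by
      rw [div_div, div_le_div_iff₀ (by positivity) (by positivity)]
      nlinarith [mul_pos hK0 hn0]
    have h5 : κ / (2 * K ^ 3) / q ≤ κ / (K * n) / 2 := by
      rw [div_div, div_div]
      gcongr κ / ?_
      have : K * n ≤ K ^ 3 * q := by
        gcongr
        exact le_self_pow₀ hK.le (by norm_num)
      linarith
    have h6 : (q : ℝ) * θ - z - p = ((q / n : ℕ) : ℝ) * (n * θ - round (n * θ)) -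
        (z - ((q % n : ℕ) * θ - (p - ((q / n : ℕ) : ℤ) * round (n * θ) : ℤ))) := by
      conv_lhs => rw [hqdm]
      rw [Int.cast_sub, Int.cast_mul, Int.cast_natCast]
      ring
    have h7 := abs_sub_abs_le_abs_sub
      (z - ((q % n : ℕ) * θ - (p - ((q / n : ℕ) : ℤ) * round (n * θ) : ℤ)))
      (((q / n : ℕ) : ℝ) * (n * θ - round (n * θ)))
    rw [h6, abs_sub_comm (((q / n : ℕ) : ℝ) * (n * θ - round (n * θ)))]
    linarith

/-- The rational affine combinations of `θ` and `1` with integer coefficient of `θ`. -/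
def exceptionalPoints (θ : ℝ) : Set ℝ := Set.range fun x : ℤ × ℚ => (x.1 : ℝ) * θ + x.2

lemma exceptionalPoints_countable (θ : ℝ) : (exceptionalPoints θ).Countable :=
  Set.countable_range _

lemma exists_forall_le_abs {θ z κ K Q₀ : ℝ} (hκ : 0 < κ) (hK : 1 < K)
    (hκK : 2 ≤ κ * K) (hQ₀ : 0 < Q₀)
    (hz : ∀ i : ℕ, ∀ w ∈ approxPoints θ (Q₀ * K ^ i), κ / (Q₀ * K ^ i) ≤ |z - w|)
    (hex : z ∉ exceptionalPoints θ) :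
    ∃ c > 0, ∀ q : ℕ, 0 < q → ∀ p : ℤ, c / q ≤ |q * θ - z - p| := by
  by_cases hθ : Irrational θ
  · obtain ⟨c, hc, N, hN⟩ := exists_forall_large_le_abs hθ hκ hK hκK hQ₀ hz
    obtain ⟨δ, hδ, hδ'⟩ := exists_forall_le_of_pos (fun q => roundDist (q * θ - z)) N (by
      intro q _ _
      refine abs_pos.2 fun h0 => hex ⟨(q, -round (q * θ - z)), ?_⟩
      push_cast
      linarith)
    refine ⟨Min.min c δ, lt_min hc hδ, fun q hq p => ?_⟩
    have hq1 : (1 : ℝ) ≤ q := by exact_mod_cast hq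
    rcases le_or_gt q N with h | h
    · calc Min.min c δ / q ≤ Min.min c δ := div_le_self (lt_min hc hδ).le hq1
        _ ≤ δ := min_le_right _ _
        _ ≤ _ := (hδ' q hq h).trans (roundDist_le _ p)
    · refine le_trans ?_ (hN q h p)
      gcongr
      exact min_le_left _ _
  · obtain ⟨x, rfl⟩ := not_not.1 hθ
    have hd : (0 : ℝ) < x.den := by exact_mod_cast x.den_pos
    have hpos : 0 < roundDist (x.den * z) := by
      refine abs_pos.2 fun h0 => hex ⟨(0, (round (x.den * z) : ℚ) / x.den), ?_⟩
      push_cast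
      rw [zero_mul, zero_add, div_eq_iff hd.ne']
      linarith
    refine ⟨roundDist (x.den * z) / x.den, by positivity, fun q hq p => ?_⟩
    have hq1 : (1 : ℝ) ≤ q := by exact_mod_cast hq
    refine (div_le_self (by positivity) hq1).trans ?_
    rw [div_le_iff₀ hd]
    have hx : (x : ℝ) * x.den = x.num := by exact_mod_cast Rat.mul_den_eq_num x
    calc roundDist (x.den * z) ≤ |x.den * z - ((q * x.num - p * x.den : ℤ) : ℝ)| :=
          roundDist_le _ _
      _ = |-(((q : ℝ) * x - z - p) * x.den)| := by
          congr 1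
          push_cast
          rw [← hx]
          ring
      _ = _ := by rw [abs_neg, abs_mul, abs_of_pos hd]

lemma mem_badTheta_of_forall {θ z : ℝ}
    (h₁ : ∃ c > 0, ∀ q : ℕ, 0 < q → ∀ p : ℤ, c / q ≤ |q * θ - z - p|)
    (h₂ : ∃ c > 0, ∀ q : ℕ, 0 < q → ∀ p : ℤ, c / q ≤ |q * (-θ) - z - p|) :
    z ∈ BadTheta θ := by
  obtain ⟨c, hc, h₁⟩ := h₁
  obtain ⟨d, hd, h₂⟩ := h₂
  refine ⟨Min.min c d, lt_min hc hd, fun q hq => le_ciInf fun p => ?_⟩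
  obtain ⟨n, rfl | rfl⟩ := q.eq_nat_or_neg
  · have hn : 0 < n := by omega
    refine le_trans ?_ ((h₁ n hn p).trans_eq (by push_cast; ring_nf))
    rw [Int.cast_natCast, Nat.abs_cast]
    gcongr
    exact min_le_left _ _
  · have hn : 0 < n := by omega
    refine le_trans ?_ ((h₂ n hn p).trans_eq (by push_cast; ring_nf))
    rw [Int.cast_neg, Int.cast_natCast, abs_neg, Nat.abs_cast]
    gcongr
    exact min_le_right _ _

lemma exists_rpow_add_three_le {r : ℝ} (hr : r < 1) :
    ∃ S : ℕ, 5 ≤ S ∧ ((S + 3 : ℕ) : ℝ) ^ r ≤ S := by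
  have hlim := (tendsto_rpow_atTop (sub_pos.2 hr)).comp tendsto_natCast_atTop_atTop
  obtain ⟨n, h8, h2⟩ := ((Filter.eventually_ge_atTop 8).and
    (hlim.eventually_ge_atTop (2 : ℝ))).exists
  obtain ⟨S, rfl⟩ := Nat.exists_eq_add_of_le' (show 3 ≤ n by omega)
  refine ⟨S, by omega, ?_⟩
  have hpos : (0 : ℝ) < ((S + 3 : ℕ) : ℝ) := by positivity
  have hS : (5 : ℝ) ≤ S := by exact_mod_cast (show 5 ≤ S by omega)
  have hmul : ((S + 3 : ℕ) : ℝ) ^ (1 - r) * ((S + 3 : ℕ) : ℝ) ^ r = S + 3 := by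
    rw [← Real.rpow_add hpos]
    simp
  have hr0 := Real.rpow_pos_of_pos hpos r
  simp only [Function.comp_apply] at h2
  nlinarith

/-- The intersection has dimension at least every `r < 1`: up to a countable set it contains the
points avoiding neighbourhoods of approximation points, where the generations with 2-adic
valuation `s` of `t + 1` deal with the `s`-th constraint. -/
lemma le_dimH_iInter_of_lt_one (θ : ℕ → ℝ) (a b : ℕ → ℝ) (ha : ∀ m : ℕ, a m ≠ 0) {r : ℝ}
    (hr0 : 0 < r) (hr1 : r < 1) :
    ENNReal.ofReal r ≤
      dimH (⋂ m : ℕ, ⋂ n : ℕ, (fun x : ℝ => a m * x + b m) '' BadTheta (θ n)) := by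
  obtain ⟨S, hS, hSr⟩ := exists_rpow_add_three_le hr1
  set R : ℝ := ((S + 3 : ℕ) : ℝ) with hRdef
  have hR8 : 8 ≤ R := by rw [hRdef]; exact_mod_cast (show 8 ≤ S + 3 by omega)
  have hR0 : 0 < R := by linarith
  obtain ⟨e, he⟩ := exists_surjective_nat (ℕ × ℕ × ℤˣ)
  let ϑ : ℕ × ℕ × ℤˣ → ℝ := fun x => ((x.2.2 : ℤ) : ℝ) * θ x.2.1
  let f : ℕ × ℕ × ℤˣ → ℝ → ℝ := fun x z => a x.1 * z + b x.1
  let P : ℕ → Set ℝ := fun t =>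
    f (e (padicValNat 2 (t + 1))) '' approxPoints (ϑ (e (padicValNat 2 (t + 1))))
      (|a (e (padicValNat 2 (t + 1))).1| / 4 * R ^ t)
  have hP : ∀ t, ∀ x ∈ P t, ∀ y ∈ P t, x ≠ y → 2 / R ^ t ≤ |x - y| := by
    rintro t _ ⟨z, hz, rfl⟩ _ ⟨w, hw, rfl⟩ hne
    have hsep := approxPoints_separated hz hw (fun h => hne (by rw [h]))
    have hapos := abs_pos.2 (ha (e (padicValNat 2 (t + 1))).1)
    have heq : f (e (padicValNat 2 (t + 1))) z - f (e (padicValNat 2 (t + 1))) w =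
        a (e (padicValNat 2 (t + 1))).1 * (z - w) := by
      simp only [f]; ring
    rw [heq, abs_mul]
    calc 2 / R ^ t = |a (e (padicValNat 2 (t + 1))).1| *
          (1 / (2 * (|a (e (padicValNat 2 (t + 1))).1| / 4 * R ^ t))) := by field_simp; norm_num
      _ ≤ _ := by gcongr
  obtain ⟨g, hgP, hg⟩ := exists_param_avoiding (by omega : 0 < S) hP
  have hdim := le_dimH_of_param (A := {x | ∀ t, ∀ p ∈ P t, 1 / R ^ (t + 1) ≤ |x - p|})
    (by linarith) (by exact_mod_cast (show 1 < S by omega)) hr0 hSr hgP hg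
  have hcount : (⋃ x, f x '' exceptionalPoints (ϑ x)).Countable :=
    Set.countable_iUnion fun x => (exceptionalPoints_countable _).image _
  set T := ⋂ m : ℕ, ⋂ n : ℕ, (fun x : ℝ => a m * x + b m) '' BadTheta (θ n)
  have hT : dimH (T ∪ ⋃ x, f x '' exceptionalPoints (ϑ x)) = dimH T := by
    rw [dimH_union, dimH_countable hcount, max_eq_left zero_le]
  refine hdim.trans ((dimH_mono ?_).trans_eq hT)
  intro x hx
  by_cases hxe : x ∈ ⋃ x, f x '' exceptionalPoints (ϑ x)
  · exact Or.inr hxe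
  refine Or.inl (Set.mem_iInter.2 fun m => Set.mem_iInter.2 fun n =>
    ⟨(x - b m) / a m, ?_, by have := ha m; simp only; field_simp; ring⟩)
  have hkey : ∀ ε : ℤˣ, ∃ c > 0, ∀ q : ℕ, 0 < q → ∀ p : ℤ,
      c / q ≤ |q * (((ε : ℤ) : ℝ) * θ n) - (x - b m) / a m - p| := by
    intro ε
    obtain ⟨s, hs⟩ := he (m, n, ε)
    have hapos := abs_pos.2 (ha m)
    have hRK : R ^ 2 ≤ R ^ 2 ^ (s + 1) := by
      gcongr
      · linarith
      · exact le_self_pow₀ (by norm_num) (by omega)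
    refine exists_forall_le_abs (κ := 1 / (4 * R)) (K := R ^ 2 ^ (s + 1))
      (Q₀ := |a m| / 4 * R ^ (2 ^ s - 1)) (by positivity) (by nlinarith) ?_ (by positivity) ?_ ?_
    · rw [div_mul_eq_mul_div, le_div_iff₀ (by positivity)]
      nlinarith
    · intro i w hw
      have ht : 2 ^ s - 1 + 2 ^ (s + 1) * i + 1 = 2 ^ s * (2 * i + 1) := by
        have : 1 ≤ 2 ^ s := Nat.one_le_two_pow
        rw [pow_succ]
        ring_nf
        omega
      have hval : padicValNat 2 (2 ^ s - 1 + 2 ^ (s + 1) * i + 1) = s := by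
        rw [ht, padicValNat.mul (by positivity) (by omega), padicValNat.prime_pow,
          padicValNat.eq_zero_of_not_dvd (by omega), add_zero]
      have hQ : |a m| / 4 * R ^ (2 ^ s - 1) * (R ^ 2 ^ (s + 1)) ^ i =
          |a m| / 4 * R ^ (2 ^ s - 1 + 2 ^ (s + 1) * i) := by
        rw [pow_add, pow_mul]; ring
      rw [hQ] at hw ⊢
      have hmem : f (m, n, ε) w ∈ P (2 ^ s - 1 + 2 ^ (s + 1) * i) := by
        simp only [P, hval, hs]
        exact ⟨w, hw, rfl⟩
      have hfar := hx _ _ hmem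
      have heq : x - f (m, n, ε) w = a m * ((x - b m) / a m - w) := by
        have := ha m
        simp only [f]
        field_simp
        ring
      rw [heq, abs_mul, ← div_le_iff₀' hapos] at hfar
      refine le_trans (le_of_eq ?_) hfar
      rw [pow_succ R]
      field_simp
    · intro hmem
      refine hxe (Set.mem_iUnion.2 ⟨(m, n, ε), _, hmem, ?_⟩)
      have := ha m
      simp only [f]
      field_simp
      ring
  refine mem_badTheta_of_forall ?_ ?_
  · simpa using hkey 1
  · simpa using hkey (-1)

/-- The intersection of the images of the sets `Bad_{θ_n}(1,1)` under countably many
invertible affine maps has full Hausdorff dimension. -/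
theorem iInter_affine_image_badTheta_dimH (θ : ℕ → ℝ) (a b : ℕ → ℝ)
    (ha : ∀ m : ℕ, a m ≠ 0) :
    dimH (⋂ m : ℕ, ⋂ n : ℕ, (fun x : ℝ => a m * x + b m) '' BadTheta (θ n)) = 1 := by
  refine le_antisymm ((dimH_mono (Set.subset_univ _)).trans_eq Real.dimH_univ) ?_
  refine ENNReal.le_of_forall_nnreal_lt fun r hr => ?_
  rcases eq_or_ne r 0 with rfl | h0
  · simp
  · have := le_dimH_iInter_of_lt_one θ a b ha (r := r) (by positivity) (by exact_mod_cast hr)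
    rwa [ENNReal.ofReal_coe_nnreal] at this
end

section
/- For any countable set {θ_n : n ∈ ℕ} of real numbers and any countable family {f_m : m ∈ ℕ} of invertible affine maps ℝ → ℝ (i.e., maps x ↦ a_m·x + b_m with a_m ≠ 0), the set ⋂_{m ∈ ℕ} ⋂_{n ∈ ℕ} f_m(Bad_{θ_n}(1,1)) is an 1/8-winning set for Schmidt's game on ℝ. -/
/-- `q` is a best approximation denominator of `θ`: it brings `q θ` strictly closer to `ℤ`
than every smaller positive integer does. -/
def IsBestDenom (θ : ℝ) (q : ℕ) : Prop :=
  0 < q ∧ ∀ m : ℕ, 0 < m → m < q → |q * θ - round (q * θ)| < |m * θ - round (m * θ)|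

/-- The distance of `m θ` to `ℤ` is at least `1 / (2 q)` for `m` below a best approximation
denominator `q`. -/
lemma IsBestDenom.le_abs_mul_sub {θ : ℝ} {q : ℕ} (hq : IsBestDenom θ q) {m : ℕ} (hm : 0 < m)
    (hmq : m < q) (p : ℤ) : 1 / (2 * q) ≤ |m * θ - p| := by
  have hlt := hq.2 m hm hmq
  refine le_trans ?_ (round_le (m * θ) p)
  by_contra! hsmall
  set u : ℤ := round (m * θ)
  set v : ℤ := round (q * θ)
  have hq0 : (0 : ℝ) < q := by exact_mod_cast hq.1
  have hm0 : (0 : ℝ) < m := by exact_mod_cast hm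
  have hmq' : (m : ℝ) < q := by exact_mod_cast hmq
  rw [lt_div_iff₀ (by positivity)] at hsmall
  have hid : ((m * v - q * u : ℤ) : ℝ) = q * (m * θ - u) - m * (q * θ - v) := by
    push_cast; ring
  have habs : |((m * v - q * u : ℤ) : ℝ)| < 1 := by
    rw [hid]
    calc |q * (m * θ - u) - m * (q * θ - v)|
        ≤ |q * (m * θ - u)| + |m * (q * θ - v)| := abs_sub _ _
      _ = q * |m * θ - u| + m * |q * θ - v| := by
          rw [abs_mul, abs_mul, abs_of_pos hq0, abs_of_pos hm0]
      _ ≤ q * |m * θ - u| + q * |m * θ - u| := by gcongr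
      _ < 1 := by linarith
  have hzero : (m * v - q * u : ℤ) = 0 := by
    rw [← Int.abs_lt_one_iff]; exact_mod_cast habs
  rw [hzero, Int.cast_zero] at hid
  have heq : q * |m * θ - u| = m * |q * θ - v| := by
    rw [← abs_of_pos hq0, ← abs_of_pos hm0, ← abs_mul, ← abs_mul, abs_of_pos hq0,
      abs_of_pos hm0, sub_eq_zero.mp hid.symm]
  nlinarith [abs_nonneg (q * θ - v), abs_nonneg (m * θ - u)]

/-- Dirichlet's theorem, with a best approximation denominator. -/
lemma exists_isBestDenom_le (θ : ℝ) {n : ℕ} (hn : 0 < n) :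
    ∃ q : ℕ, IsBestDenom θ q ∧ q ≤ n ∧ |q * θ - round (q * θ)| ≤ 1 / (n + 1) := by
  classical
  obtain ⟨k, hk, hkn, hkθ⟩ := Real.exists_nat_abs_mul_sub_round_le θ hn
  have hex : ∃ q : ℕ, 0 < q ∧ |q * θ - round (q * θ)| ≤ 1 / (n + 1) := ⟨k, hk, hkθ⟩
  obtain ⟨hpos, hle⟩ := Nat.find_spec hex
  refine ⟨Nat.find hex, ⟨hpos, fun m hm hmq => ?_⟩, (Nat.find_min' hex ⟨hk, hkθ⟩).trans hkn, hle⟩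
  have := Nat.find_min hex hmq
  push Not at this
  exact hle.trans_lt (this hm)

/-- To be in `BadTheta θ` it suffices to stay `κ / q` away from the points `θ r + p` with
`|r| < q`, for each best approximation denominator `q`. -/
lemma mem_badTheta_of_isBestDenom {θ y κ : ℝ} (hκ : 0 < κ) (hκ1 : κ ≤ 1)
    (h : ∀ q : ℕ, IsBestDenom θ q → ∀ r p : ℤ, |r| < q → κ / q ≤ |y - (θ * r + p)|) :
    y ∈ BadTheta θ := by
  refine ⟨(κ / 2) ^ 2, by positivity, fun m hm => le_ciInf fun p => ?_⟩
  have hm0 : (0 : ℝ) < |(m : ℝ)| := by positivity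
  have hm1 : (1 : ℝ) ≤ |(m : ℝ)| := by exact_mod_cast Int.one_le_abs hm
  have hX1 : 1 ≤ |(m : ℝ)| / (κ / 2) := by rw [le_div_iff₀ (by positivity)]; linarith
  obtain ⟨q, hq, hqn, hqθ⟩ := exists_isBestDenom_le θ (Nat.floor_pos.mpr hX1)
  have hq0 : (0 : ℝ) < q := by exact_mod_cast hq.1
  have hqX : (q : ℝ) ≤ |(m : ℝ)| / (κ / 2) :=
    (Nat.le_floor_iff (by positivity)).mp hqn
  have herr : |q * θ - round (q * θ)| ≤ (κ / 2) / |(m : ℝ)| := by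
    refine hqθ.trans ?_
    rw [← one_div_div |(m : ℝ)| (κ / 2)]
    exact one_div_le_one_div_of_le (by positivity) (Nat.lt_floor_add_one _).le
  set j : ℤ := m.tdiv q
  set r : ℤ := m.tmod q
  have hdecomp : (m : ℝ) = q * j + r := by
    exact_mod_cast (Int.mul_tdiv_add_tmod m q).symm
  have hr : |r| < q := by
    have := Int.natAbs_tmod m q
    have h2 : m.natAbs % (q : ℤ).natAbs < q := by simpa using Nat.mod_lt _ hq.1
    rw [Int.abs_eq_natAbs, this]; exact_mod_cast h2
  have hj : |(j : ℝ)| * q ≤ |(m : ℝ)| := by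
    have h1 : j.natAbs = m.natAbs / q := by
      rw [Int.natAbs_tdiv, Int.natAbs_natCast]; rfl
    have h2 : j.natAbs * q ≤ m.natAbs := by rw [h1]; exact Nat.div_mul_le_self _ _
    have h3 : ((j.natAbs * q : ℕ) : ℝ) ≤ m.natAbs := by exact_mod_cast h2
    simpa [Nat.cast_natAbs] using h3
  have hmain := h q hq r (j * round (q * θ) - p) hr
  set e : ℝ := q * θ - round (q * θ) with he
  have hje : |j * e| ≤ (κ / 2) / q := by
    rw [abs_mul]
    calc |(j : ℝ)| * |e| ≤ (|(m : ℝ)| / q) * ((κ / 2) / |(m : ℝ)|) := by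
          gcongr
          rwa [le_div_iff₀ hq0]
      _ = (κ / 2) / q := by field_simp
  have hid : θ * m - y - p = -(y - (θ * r + (j * round (q * θ) - p : ℤ))) + j * e := by
    rw [hdecomp, he]; push_cast; ring
  have htri : |y - (θ * r + (j * round (q * θ) - p : ℤ))| - |j * e| ≤ |θ * m - y - p| := by
    rw [hid, ← abs_neg (y - _), ← abs_neg (j * e)]
    simpa using abs_sub_abs_le_abs_sub (-(y - (θ * r + (j * round (q * θ) - p : ℤ)))) (-(j * e))
  have hlow : (κ / 2) ^ 2 / |(m : ℝ)| ≤ (κ / 2) / q := by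
    rw [le_div_iff₀ (by positivity)] at hqX
    rw [div_le_div_iff₀ hm0 hq0]
    nlinarith
  have hhalf : κ / q = (κ / 2) / q + (κ / 2) / q := by ring
  linarith

/-- The points `θ s r + p` with `0 ≤ r < q` for a best approximation denominator `q ≤ Q`. -/
def orbitPoints (θ s Q : ℝ) : Set ℝ :=
  {z | ∃ q r : ℕ, ∃ p : ℤ, IsBestDenom θ q ∧ (q : ℝ) ≤ Q ∧ r < q ∧ z = s * (r * θ) + p}

lemma orbitPoints_separated {θ s Q : ℝ} (hs : |s| = 1) {z w : ℝ}
    (hz : z ∈ orbitPoints θ s Q) (hw : w ∈ orbitPoints θ s Q) (hne : z ≠ w) :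
    1 / (2 * Q) ≤ |z - w| := by
  obtain ⟨q, r, p, hq, hqQ, hr, rfl⟩ := hz
  obtain ⟨q', r', p', hq', hqQ', hr', rfl⟩ := hw
  wlog hle : r' ≤ r generalizing q r p q' r' p'
  · rw [abs_sub_comm]
    exact this q' r' p' hq' hqQ' hr' q r p hq hqQ hr hne.symm (by omega)
  have hq0 : (1 : ℝ) ≤ q := by exact_mod_cast hq.1
  have hsep : 1 / (2 * (q : ℝ)) ≤ |s * (r * θ) + p - (s * (r' * θ) + p')| := by
    rcases hle.eq_or_lt with rfl | hlt
    · have hpp : p - p' ≠ 0 := fun h => hne (by rw [sub_eq_zero.mp h])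
      have h1 : (1 : ℝ) ≤ |((p - p' : ℤ) : ℝ)| := by exact_mod_cast Int.one_le_abs hpp
      push_cast at h1
      rw [add_sub_add_left_eq_sub]
      refine le_trans ?_ h1
      rw [div_le_one (by positivity)]; linarith
    · have key (k : ℤ) := hq.le_abs_mul_sub (m := r - r') (by omega) (by omega) k
      rw [Nat.cast_sub hlt.le] at key
      rcases eq_or_eq_neg_of_abs_eq hs with rfl | rfl
      · convert key (p' - p) using 2
        push_cast; ring
      · rw [← abs_neg]
        convert key (p - p') using 2
        push_cast; ring
  refine le_trans ?_ hsep
  gcongr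

/-- In a ball of radius `ρ` White can find a ball of radius `ρ / 8` that keeps distance `ρ / 8`
from two `4 ρ`-separated sets. -/
lemma exists_ball_avoiding_separated {ρ : ℝ} (hρ : 0 < ρ) (x : ℝ) (A : Bool → Set ℝ)
    (hA : ∀ i, ∀ z ∈ A i, ∀ w ∈ A i, z ≠ w → 4 * ρ ≤ |z - w|) :
    ∃ c : ℝ, |c - x| ≤ 7 / 8 * ρ ∧ ∀ i, ∀ z ∈ A i, ρ / 4 ≤ |z - c| := by
  by_contra! hcon
  have hbad (k : Fin 3) : ∃ i, ∃ z ∈ A i, |z - (x + ((k : ℝ) - 1) * (7 / 8 * ρ))| < ρ / 4 := by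
    refine hcon _ ?_
    rw [add_sub_cancel_left, abs_le]
    fin_cases k <;> constructor <;> norm_num <;> linarith
  choose i z hz hzc using hbad
  obtain ⟨k, l, hkl, hi⟩ := Fintype.exists_ne_map_eq_of_card_lt i (by simp)
  wlog hlt : k < l generalizing k l
  · exact this l k hkl.symm hi.symm (lt_of_le_of_ne (not_lt.mp hlt) hkl.symm)
  have hk := abs_lt.mp (hzc k)
  have hl := abs_lt.mp (hzc l)
  have h1 : (k : ℝ) + 1 ≤ (l : ℝ) := by exact_mod_cast hlt
  have h2 : (l : ℝ) ≤ 2 := by exact_mod_cast Nat.lt_succ_iff.mp l.isLt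
  have h3 : (0 : ℝ) ≤ (k : ℝ) := by positivity
  have hne : z l ≠ z k := fun h => by nlinarith
  have hfar := hA (i k) (z l) (hi ▸ hz l) (z k) (hz k) hne
  have : |z l - z k| < 4 * ρ := by rw [abs_lt]; constructor <;> nlinarith
  linarith

/-- A turn of White: the chosen ball avoids the images of the points `θ r + p` relevant to the
scale of Black's ball. -/
lemma exists_ball_avoiding_orbitPoints (θ a b : ℝ) (ha : a ≠ 0) {ρ : ℝ} (hρ : 0 < ρ) (x : ℝ) :
    ∃ c : ℝ, |c - x| ≤ 7 / 8 * ρ ∧ ∀ s : ℝ, |s| = 1 →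
      ∀ z ∈ orbitPoints θ s (|a| / (8 * ρ)), ρ / 4 ≤ |a * z + b - c| := by
  have ha0 : 0 < |a| := abs_pos.mpr ha
  obtain ⟨c, hc, hsep⟩ := exists_ball_avoiding_separated hρ x
    (fun i => (fun z => a * z + b) '' orbitPoints θ (bif i then 1 else -1) (|a| / (8 * ρ))) (by
      rintro i _ ⟨z, hz, rfl⟩ _ ⟨w, hw, rfl⟩ hne
      have h := orbitPoints_separated (by cases i <;> simp) hz hw (fun h => hne (by rw [h]))
      have hid : a * z + b - (a * w + b) = a * (z - w) := by ring
      rw [hid, abs_mul]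
      calc 4 * ρ = |a| * (1 / (2 * (|a| / (8 * ρ)))) := by field_simp; norm_num
        _ ≤ |a| * |z - w| := by gcongr)
  refine ⟨c, hc, fun s hs z hz => ?_⟩
  rcases eq_or_eq_neg_of_abs_eq hs with rfl | rfl
  · exact hsep true _ ⟨z, hz, rfl⟩
  · exact hsep false _ ⟨z, hz, rfl⟩

/-- Every natural number is the `2`-adic valuation of a member of each long enough interval. -/
lemma exists_padicValNat_two_eq (i n : ℕ) :
    ∃ t, n ≤ t ∧ t ≤ n + 3 * 2 ^ i ∧ padicValNat 2 t = i := by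
  have hpos : 0 < 2 ^ i := by positivity
  have h1 := Nat.div_add_mod n (2 * 2 ^ i)
  have h2 := Nat.mod_lt n (show 0 < 2 * 2 ^ i by positivity)
  refine ⟨2 ^ i * (2 * (n / (2 * 2 ^ i) + 1) + 1), ?_, ?_, ?_⟩
  · nlinarith
  · nlinarith [Nat.zero_le (n % (2 * 2 ^ i))]
  · rw [padicValNat.mul (by positivity) (by omega), padicValNat.prime_pow,
      padicValNat.eq_zero_of_not_dvd (by omega), add_zero]

/-- A geometric sequence sampled along a set with bounded gaps meets `[q, C q]` for all `q ≥ 1`. -/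
lemma exists_geometric_mem {L Q₀ : ℝ} (hL : 1 < L) (hQ₀ : 0 < Q₀) (P : ℕ → Prop) (M : ℕ)
    (hP : ∀ n, ∃ t, n ≤ t ∧ t ≤ n + M ∧ P t) :
    ∃ C : ℝ, 1 ≤ C ∧ ∀ q : ℝ, 1 ≤ q → ∃ t, P t ∧ q ≤ Q₀ * L ^ t ∧ Q₀ * L ^ t ≤ C * q := by
  classical
  have hLM : 1 ≤ L ^ M := one_le_pow₀ hL.le
  refine ⟨max L Q₀ * L ^ M, one_le_mul_of_one_le_of_one_le (hL.le.trans (le_max_left _ _)) hLM,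
    fun q hq => ?_⟩
  have hex : ∃ n : ℕ, q ≤ Q₀ * L ^ n := by
    obtain ⟨n, hn⟩ := pow_unbounded_of_one_lt (q / Q₀) hL
    exact ⟨n, by rw [div_lt_iff₀ hQ₀] at hn; linarith⟩
  have hfirst : Q₀ * L ^ Nat.find hex ≤ max L Q₀ * q := by
    rcases hn : Nat.find hex with _ | n
    · rw [pow_zero, mul_one]
      nlinarith [le_max_right L Q₀]
    · have h := not_le.mp (Nat.find_min hex (m := n) (by omega))
      calc Q₀ * L ^ (n + 1) = L * (Q₀ * L ^ n) := by ring
        _ ≤ max L Q₀ * q := by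
          gcongr
          exact le_max_left _ _
  obtain ⟨t, hnt, htM, hPt⟩ := hP (Nat.find hex)
  refine ⟨t, hPt, (Nat.find_spec hex).trans ?_, ?_⟩
  · gcongr
    exact hL.le
  · calc Q₀ * L ^ t ≤ Q₀ * L ^ (Nat.find hex + M) := by
          gcongr
          exact hL.le
      _ = Q₀ * L ^ Nat.find hex * L ^ M := by ring
      _ ≤ max L Q₀ * q * L ^ M := by gcongr
      _ = max L Q₀ * L ^ M * q := by ring

/-- A point keeping distance `ρ / 8` from the relevant points at all turns `t` satisfying `P`,
where `ρ` is the radius of Black's ball, lies in the image of `BadTheta θ`. -/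
lemma mem_image_badTheta {θ a b x ρ₀ L : ℝ} (ha : a ≠ 0) (hρ₀ : 0 < ρ₀) (hL : 1 < L)
    (ρ : ℕ → ℝ) (hρ : ∀ t, ρ t = ρ₀ / L ^ t) (P : ℕ → Prop) (M : ℕ)
    (hP : ∀ n, ∃ t, n ≤ t ∧ t ≤ n + M ∧ P t)
    (h : ∀ t, P t → ∀ s : ℝ, |s| = 1 → ∀ z ∈ orbitPoints θ s (|a| / (8 * ρ t)),
      ρ t / 8 ≤ |a * z + b - x|) :
    x ∈ (fun y : ℝ => a * y + b) '' BadTheta θ := by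
  have ha0 : 0 < |a| := abs_pos.mpr ha
  refine ⟨(x - b) / a, ?_, by field_simp; ring⟩
  obtain ⟨C, hC, hgeo⟩ :=
    exists_geometric_mem hL (Q₀ := |a| / (8 * ρ₀)) (by positivity) P M hP
  have hscale (t : ℕ) : |a| / (8 * ρ t) = |a| / (8 * ρ₀) * L ^ t := by
    rw [hρ]; field_simp
  refine mem_badTheta_of_isBestDenom (κ := 1 / (64 * C)) (by positivity)
    (by rw [div_le_one (by positivity)]; linarith) fun q hq r p hr => ?_
  have hq1 : (1 : ℝ) ≤ q := by exact_mod_cast hq.1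
  obtain ⟨t, hPt, hqt, htq⟩ := hgeo q hq1
  rw [← hscale] at hqt htq
  have hρt : 0 < ρ t := by rw [hρ]; positivity
  obtain ⟨s, hs, hmem⟩ : ∃ s : ℝ, |s| = 1 ∧
      θ * r + p ∈ orbitPoints θ s (|a| / (8 * ρ t)) := by
    have hrq : r.natAbs < q := by rw [Int.abs_eq_natAbs] at hr; exact_mod_cast hr
    rcases Int.natAbs_eq r with h | h
    · refine ⟨1, abs_one, q, r.natAbs, p, hq, hqt, hrq, ?_⟩
      have hr' : (r : ℝ) = (r.natAbs : ℝ) := (congrArg Int.cast h).trans (Int.cast_natCast _)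
      rw [hr']; ring
    · refine ⟨-1, by simp, q, r.natAbs, p, hq, hqt, hrq, ?_⟩
      have hr' : (r : ℝ) = -(r.natAbs : ℝ) := by exact_mod_cast h
      rw [hr']; ring
  have hdist := h t hPt s hs _ hmem
  have hid : a * (θ * r + p) + b - x = -(a * ((x - b) / a - (θ * r + p))) := by
    field_simp; ring
  rw [hid, abs_neg, abs_mul] at hdist
  rw [div_le_iff₀ (by positivity)] at htq
  rw [div_div, div_le_iff₀ (by positivity)]
  have h8 : |a| ≤ |a| * (|(x - b) / a - (θ * r + p)| * (64 * C * q)) := by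
    calc |a| ≤ C * q * (8 * ρ t) := htq
      _ = (64 * C * q) * (ρ t / 8) := by ring
      _ ≤ (64 * C * q) * (|a| * |(x - b) / a - (θ * r + p)|) := by gcongr
      _ = _ := by ring
  exact (le_mul_iff_one_le_right ha0).mp h8

/-- The intersection of the images of the sets `Bad_{θ_n}(1,1)` under countably many
invertible affine maps is `1/8`-winning. -/
theorem iInter_affine_image_badTheta_winning (θ : ℕ → ℝ) (a b : ℕ → ℝ)
    (ha : ∀ m : ℕ, a m ≠ 0) :
    SchmidtAlphaWinning (1 / 8)
      (⋂ m : ℕ, ⋂ n : ℕ, (fun x : ℝ => a m * x + b m) '' BadTheta (θ n)) := by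
  intro β hβ hβ1
  have hturn (t : ℕ) (B : ℝ × ℝ) : ∃ c : ℝ, 0 < B.2 → |c - B.1| ≤ 7 / 8 * B.2 ∧
      ∀ s : ℝ, |s| = 1 →
        ∀ z ∈ orbitPoints (θ (padicValNat 2 t).unpair.2) s
          (|a (padicValNat 2 t).unpair.1| / (8 * B.2)),
        B.2 / 4 ≤ |a (padicValNat 2 t).unpair.1 * z + b (padicValNat 2 t).unpair.1 - c| := by
    by_cases hB : 0 < B.2
    · obtain ⟨c, hc⟩ := exists_ball_avoiding_orbitPoints (θ (padicValNat 2 t).unpair.2)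
        _ (b (padicValNat 2 t).unpair.1) (ha (padicValNat 2 t).unpair.1) hB B.1
      exact ⟨c, fun _ => hc⟩
    · exact ⟨0, fun h => absurd h hB⟩
  choose c hc using hturn
  refine ⟨fun l => (c (l.length - 1) (l.getLastD 0), 1 / 8 * (l.getLastD 0).2),
    fun B hB0 hB => ?_⟩
  have hlast (n : ℕ) : (List.ofFn (fun i : Fin (n + 1) => B i)).getLastD 0 = B n := by
    simp [-List.ofFn_succ, List.getLast?_eq_getElem?]
  simp only [hlast, List.length_ofFn, Nat.add_sub_cancel] at hB ⊢
  have hrad (t : ℕ) : (B t).2 = (B 0).2 / (8 / β) ^ t := by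
    induction t with
    | zero => simp
    | succ t ih => rw [(hB t).1, ih, pow_succ]; field_simp
  have hpos (t : ℕ) : 0 < (B t).2 := by rw [hrad]; positivity
  refine ⟨fun n => ⟨trivial, Metric.closedBall_subset_closedBall' ?_⟩, fun x hx => ?_⟩
  · rw [Real.dist_eq]
    linarith [(hc n (B n) (hpos n)).1]
  · simp only [Set.mem_iInter] at hx ⊢
    intro m n
    refine mem_image_badTheta (ha m) hB0 (L := 8 / β) (by rw [lt_div_iff₀ hβ]; linarith)
      (fun t => (B t).2) hrad (fun t => padicValNat 2 t = Nat.pair m n) _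
      (exists_padicValNat_two_eq _) fun t ht s hs z hz => ?_
    have havoid := (hc t (B t) (hpos t)).2 s hs
    rw [ht, Nat.unpair_pair] at havoid
    have hfar := havoid z hz
    have hnear : |x - c t (B t)| ≤ 1 / 8 * (B t).2 := by
      simpa [ballOf, Real.dist_eq] using (hB t).2 (hx (t + 1))
    have htri := abs_sub_le (a m * z + b m) x (c t (B t))
    linarith
end

section
/- For any real number θ, the set Bad⁺_θ := {x ∈ ℝ : ∃ c > 0 such that for every natural number q ≥ 1, ‖θq − x‖_ℤ ≥ c/q} has Hausdorff dimension 1. -/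
/-- `Bad⁺_θ`: the set of `x` such that for some `c > 0`,
`‖θq − x‖_ℤ ≥ c/q` for all natural numbers `q ≥ 1`. -/
def BadPlus (θ : ℝ) : Set ℝ :=
  {x : ℝ | ∃ c > 0, ∀ q : ℕ, 1 ≤ q → normZ (θ * q - x) ≥ c / q}

open Filter Topology

theorem normZ_eq_abs_sub_round (x : ℝ) : normZ x = |x - round x| :=
  le_antisymm (ciInf_le ⟨0, by rintro _ ⟨p, rfl⟩; exact abs_nonneg _⟩ (round x))
    (le_ciInf fun p => round_le x p)

theorem normZ_nonneg (x : ℝ) : 0 ≤ normZ x := by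
  rw [normZ_eq_abs_sub_round]
  exact abs_nonneg _

theorem normZ_le_abs_sub (x : ℝ) (p : ℤ) : normZ x ≤ |x - p| := by
  rw [normZ_eq_abs_sub_round]
  exact round_le x p

theorem normZ_natCast_mul_le (q m : ℕ) (θ x : ℝ) :
    normZ (m * x) ≤ q * normZ (m * θ) + m * normZ (θ * q - x) := by
  refine (normZ_le_abs_sub _ (q * round (m * θ) - m * round (θ * q - x))).trans ?_
  rw [normZ_eq_abs_sub_round (m * θ), normZ_eq_abs_sub_round (θ * q - x)]
  have h : (m : ℝ) * x - ((q * round (m * θ) - m * round (θ * q - x) : ℤ) : ℝ)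
      = q * (m * θ - round (m * θ)) - m * (θ * q - x - round (θ * q - x)) := by
    push_cast
    ring
  rw [h]
  refine (abs_sub _ _).trans ?_
  rw [abs_mul, abs_mul, Nat.abs_cast, Nat.abs_cast]

/-- Two points at distance at most `1 / (m * R)`, whose multiples by `m` are both close to the
integers, are close to each other. -/
theorem mul_abs_sub_lt_of_normZ_lt {m x y δ : ℝ} (hm : 0 ≤ m) (hx : normZ (m * x) < δ)
    (hy : normZ (m * y) < δ) (hxy : m * |x - y| + 2 * δ ≤ 1) : m * |x - y| < 2 * δ := by
  rw [normZ_eq_abs_sub_round] at hx hy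
  have hmul : m * |x - y| = |m * x - m * y| := by
    rw [← mul_sub, abs_mul, abs_of_nonneg hm]
  rw [hmul] at hxy ⊢
  have hlt : |((round (m * x) - round (m * y) : ℤ) : ℝ)| < 1 := by
    push_cast
    rw [abs_lt] at *
    have := abs_le.1 (le_refl |m * x - m * y|)
    constructor <;> linarith
  have h0 : round (m * x) - round (m * y) = 0 := by
    rw [← Int.abs_lt_one_iff]
    exact_mod_cast hlt
  rw [sub_eq_zero.1 h0] at hx
  rw [abs_lt] at *
  constructor <;> linarith

/-- A set which contains the image of the `N`-adic digit sequences under a map separating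
sequences which first differ at place `n` by `R⁻⁽ⁿ⁺¹⁾` has dimension at least
`log N / log R`. -/
theorem le_dimH_of_separated_digits {N R : ℕ} (hN : 2 ≤ N) (hR : 2 ≤ R) {S : Set ℝ}
    (g : (ℕ → Fin N) → ℝ) (hgS : ∀ u, g u ∈ S)
    (hsep : ∀ u v n, (∀ i < n, u i = v i) → u n ≠ v n →
      ((R : ℝ) ^ (n + 1))⁻¹ ≤ |g u - g v|) :
    ENNReal.ofReal (Real.log N / Real.log R) ≤ dimH S := by
  have hN' : (1 : ℝ) < N := by exact_mod_cast hN
  have hR' : (1 : ℝ) < R := by exact_mod_cast hR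
  have hlogR := Real.log_pos hR'
  have hr : 0 < Real.log N / Real.log R := div_pos (Real.log_pos hN') hlogR
  set r : ℝ := Real.log N / Real.log R with hr_def
  have hpow : (R : ℝ) ^ r = N := by
    rw [Real.rpow_def_of_pos (by linarith), hr_def, mul_div_cancel₀ _ hlogR.ne',
      Real.exp_log (by linarith)]
  have key : ∀ u v : ℕ → Fin N,
      |Real.ofDigits u - Real.ofDigits v| ≤ N * |g u - g v| ^ r := by
    intro u v
    by_cases huv : u = v
    · subst huv
      simp [Real.zero_rpow hr.ne']
    have hex : ∃ n, u n ≠ v n := Function.ne_iff.1 huv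
    classical
    have hlt : ∀ i < Nat.find hex, u i = v i := fun i hi => not_not.1 (Nat.find_min hex hi)
    calc |Real.ofDigits u - Real.ofDigits v| ≤ ((N : ℝ) ^ Nat.find hex)⁻¹ :=
          Real.abs_ofDigits_sub_ofDigits_le hlt
      _ = N * (((R : ℝ) ^ (Nat.find hex + 1))⁻¹) ^ r := by
          rw [Real.inv_rpow (by positivity), ← Real.rpow_natCast_mul (by positivity),
            mul_comm _ r, Real.rpow_mul_natCast (by positivity), hpow, pow_succ]
          field_simp
      _ ≤ N * |g u - g v| ^ r := by
          gcongr
          exact hsep u v _ hlt (Nat.find_spec hex)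
  have hinj : Function.Injective g := by
    intro u v huv
    by_contra hne
    have hex : ∃ n, u n ≠ v n := Function.ne_iff.1 hne
    classical
    have := hsep u v _ (fun i hi => not_not.1 (Nat.find_min hex hi)) (Nat.find_spec hex)
    rw [huv, sub_self, abs_zero] at this
    have : 0 < ((R : ℝ) ^ (Nat.find hex + 1))⁻¹ := by positivity
    linarith
  have : Nonempty (ℕ → Fin N) := ⟨fun _ => ⟨0, by omega⟩⟩
  have hholder : HolderOnWith (N : NNReal) r.toNNReal
      (fun x => Real.ofDigits (Function.invFun g x)) (Set.range g) := by
    rintro _ ⟨u, rfl⟩ _ ⟨v, rfl⟩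
    simp only [Function.leftInverse_invFun hinj _]
    rw [edist_dist, edist_dist, Real.dist_eq, Real.dist_eq, Real.coe_toNNReal _ hr.le,
      ENNReal.ofReal_rpow_of_nonneg (abs_nonneg _) hr.le, ENNReal.coe_natCast,
      ← ENNReal.ofReal_natCast, ← ENNReal.ofReal_mul (by positivity)]
    exact ENNReal.ofReal_le_ofReal (key u v)
  have hIcc : Set.Icc (0 : ℝ) 1 ⊆
      (fun x => Real.ofDigits (Function.invFun g x)) '' Set.range g := by
    intro y hy
    obtain ⟨u, -, rfl⟩ := Real.ofDigits_SurjOn (b := N) (by omega) hy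
    exact ⟨g u, ⟨u, rfl⟩, by simp only [Function.leftInverse_invFun hinj _]⟩
  have hdim : dimH (Set.Icc (0 : ℝ) 1) = 1 := by
    rw [Real.dimH_of_nonempty_interior (by simp)]
    simp
  have h1 := hdim ▸ (dimH_mono hIcc).trans
    (hholder.dimH_image_le (Real.toNNReal_pos.2 hr))
  rw [ENNReal.le_div_iff_mul_le (Or.inl (by simpa using hr)) (Or.inl ENNReal.coe_ne_top),
    one_mul] at h1
  exact h1.trans (dimH_mono (Set.range_subset_iff.2 hgS))

/-- The left endpoints, in units of `(2 * N + 2)⁻ⁿ`, of the intervals of a Cantor construction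
where each interval is cut into `2 * N + 2` pieces, every other piece is retained, and among those
a single one, given by `B`, is discarded. -/
def cantorIndex {N : ℕ} (B : ℕ → ℕ → Fin (N + 1)) (u : ℕ → Fin N) : ℕ → ℕ
  | 0 => 0
  | n + 1 => (2 * N + 2) * cantorIndex B u n +
      2 * ((B n (cantorIndex B u n)).succAbove (u n) : ℕ)

theorem cantorIndex_congr {N : ℕ} (B : ℕ → ℕ → Fin (N + 1)) {u v : ℕ → Fin N} {n : ℕ}
    (h : ∀ i < n, u i = v i) : cantorIndex B u n = cantorIndex B v n := by
  induction n with
  | zero => rfl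
  | succ n ih =>
    simp only [cantorIndex, ih fun i hi => h i (by omega), h n (by omega)]

/-- The `n`-th level interval with index `a` of the `R`-adic subdivision. -/
def adicIcc (R n a : ℕ) : Set ℝ := Set.Icc ((a : ℝ) / (R : ℝ) ^ n) ((a + 1 : ℝ) / (R : ℝ) ^ n)

theorem adicIcc_mul_add_subset {R n a d : ℕ} (hd : d < R) :
    adicIcc R (n + 1) (R * a + d) ⊆ adicIcc R n a := by
  have hR : (0 : ℝ) < R := by exact_mod_cast (by omega : 0 < R)
  have hd' : (d : ℝ) + 1 ≤ R := by exact_mod_cast hd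
  apply Set.Icc_subset_Icc
  · rw [div_le_div_iff₀ (by positivity) (by positivity), pow_succ]
    push_cast
    have : 0 ≤ (d : ℝ) * (R : ℝ) ^ n := by positivity
    nlinarith
  · rw [div_le_div_iff₀ (by positivity) (by positivity), pow_succ]
    push_cast
    have : ((d : ℝ) + 1) * (R : ℝ) ^ n ≤ R * (R : ℝ) ^ n := by gcongr
    nlinarith

theorem abs_sub_le_of_mem_adicIcc {R n a : ℕ} {x y : ℝ}
    (hx : x ∈ adicIcc R n a) (hy : y ∈ adicIcc R n a) : |x - y| ≤ ((R : ℝ) ^ n)⁻¹ := by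
  have h : ((a : ℝ) + 1) / (R : ℝ) ^ n = a / (R : ℝ) ^ n + ((R : ℝ) ^ n)⁻¹ := by ring
  rw [abs_sub_le_iff]
  constructor <;> linarith [hx.1, hx.2, hy.1, hy.2]

theorem inv_pow_le_abs_sub_of_mem_adicIcc {R n a b : ℕ} {x y : ℝ} (hab : a + 2 ≤ b)
    (hx : x ∈ adicIcc R n a) (hy : y ∈ adicIcc R n b) : ((R : ℝ) ^ n)⁻¹ ≤ |x - y| := by
  have h : (a : ℝ) + 2 ≤ b := by exact_mod_cast hab
  have h2 : ((a : ℝ) + 2) / (R : ℝ) ^ n ≤ b / (R : ℝ) ^ n := by gcongr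
  have h3 : ((a : ℝ) + 2) / (R : ℝ) ^ n = (a + 1) / (R : ℝ) ^ n + ((R : ℝ) ^ n)⁻¹ := by ring
  rw [abs_sub_comm]
  exact le_trans (by linarith [hx.2, hy.1]) (le_abs_self _)

theorem inv_pow_le_abs_sub_of_even {R n a j k : ℕ} {x y : ℝ} (hjk : j ≠ k)
    (hx : x ∈ adicIcc R n (a + 2 * j)) (hy : y ∈ adicIcc R n (a + 2 * k)) :
    ((R : ℝ) ^ n)⁻¹ ≤ |x - y| := by
  rcases lt_or_gt_of_ne hjk with h | h
  · exact inv_pow_le_abs_sub_of_mem_adicIcc (by omega) hx hy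
  · rw [abs_sub_comm]
    exact inv_pow_le_abs_sub_of_mem_adicIcc (by omega) hy hx

theorem exists_mem_adicIcc_cantorIndex {N : ℕ} (B : ℕ → ℕ → Fin (N + 1)) (u : ℕ → Fin N) :
    ∃ x : ℝ, ∀ n, x ∈ adicIcc (2 * N + 2) n (cantorIndex B u n) := by
  have hanti : Antitone fun n => adicIcc (2 * N + 2) n (cantorIndex B u n) :=
    antitone_nat_of_succ_le fun n => adicIcc_mul_add_subset (by omega)
  have h := ciSup_mem_iInter_Icc_of_antitone_Icc hanti
    fun n => by gcongr; linarith
  exact ⟨_, Set.mem_iInter.1 h⟩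

theorem le_dimH_of_cantor {N : ℕ} (hN : 2 ≤ N) {S : Set ℝ} (B : ℕ → ℕ → Fin (N + 1))
    (hS : ∀ x : ℝ, (∀ n, ∃ a : ℕ, ∃ j : Fin (N + 1), j ≠ B n a ∧
      x ∈ adicIcc (2 * N + 2) (n + 1) ((2 * N + 2) * a + 2 * j)) → x ∈ S) :
    ENNReal.ofReal (Real.log N / Real.log (2 * N + 2 : ℕ)) ≤ dimH S := by
  choose g hg using exists_mem_adicIcc_cantorIndex B
  refine le_dimH_of_separated_digits hN (by omega) g
    (fun u => hS _ fun n => ⟨cantorIndex B u n, _, Fin.succAbove_ne _ (u n), hg u (n + 1)⟩) ?_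
  intro u v n huv hn
  have hu := hg u (n + 1)
  have hv := hg v (n + 1)
  simp only [cantorIndex] at hu hv
  rw [← cantorIndex_congr B huv] at hv
  refine inv_pow_le_abs_sub_of_even ?_ hu hv
  exact fun h => hn (Fin.succAbove_right_injective (Fin.ext h))

theorem exists_discarded_digit {N n a m : ℕ} (hm : m * (2 * N + 2) ≤ (2 * N + 2) ^ n)
    (hm' : (2 * N + 2) ^ n ≤ m * (2 * N + 2) ^ 2) :
    ∃ b : Fin (N + 1), ∀ j : Fin (N + 1), j ≠ b →
      ∀ x ∈ adicIcc (2 * N + 2) (n + 1) ((2 * N + 2) * a + 2 * j),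
        (2 * ((2 * N + 2 : ℕ) : ℝ) ^ 3)⁻¹ ≤ normZ (m * x) := by
  by_cases hex : ∃ b : Fin (N + 1), ∃ y ∈ adicIcc (2 * N + 2) (n + 1) ((2 * N + 2) * a + 2 * b),
      normZ (m * y) < (2 * ((2 * N + 2 : ℕ) : ℝ) ^ 3)⁻¹
  · obtain ⟨b, y, hy, hny⟩ := hex
    refine ⟨b, fun j hjb x hx => ?_⟩
    by_contra! hnx
    have hsep := inv_pow_le_abs_sub_of_even (fun h => hjb (Fin.ext h)) hx hy
    have hle := abs_sub_le_of_mem_adicIcc (adicIcc_mul_add_subset (by omega) hx)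
      (adicIcc_mul_add_subset (by omega) hy)
    have hR : (2 : ℝ) ≤ (2 * N + 2 : ℕ) := by exact_mod_cast (by omega : 2 ≤ 2 * N + 2)
    generalize 2 * N + 2 = R at *
    have h1 : (m : ℝ) * R ≤ (R : ℝ) ^ n := by exact_mod_cast hm
    have h2 : (R : ℝ) ^ n ≤ m * (R : ℝ) ^ 2 := by exact_mod_cast hm'
    have h3 : (m : ℝ) * |x - y| ≤ (R : ℝ)⁻¹ := by
      calc (m : ℝ) * |x - y| ≤ m * ((R : ℝ) ^ n)⁻¹ := by gcongr
        _ ≤ (R : ℝ)⁻¹ := by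
          rw [← div_eq_mul_inv, div_le_iff₀ (by positivity), inv_mul_eq_div,
            le_div_iff₀ (by positivity)]
          exact h1
    have h4 : (R : ℝ)⁻¹ ≤ 2⁻¹ := by gcongr
    have h5 : 2 * (2 * (R : ℝ) ^ 3)⁻¹ = ((R : ℝ) ^ 3)⁻¹ := by field_simp
    have h6 : ((R : ℝ) ^ 3)⁻¹ ≤ 2⁻¹ := by
      gcongr
      nlinarith [sq_nonneg (R : ℝ), mul_nonneg (sq_nonneg (R : ℝ)) (by linarith : (0 : ℝ) ≤ R - 2)]
    have h7 := mul_abs_sub_lt_of_normZ_lt (Nat.cast_nonneg m) hnx hny (by linarith)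
    rw [h5] at h7
    have h8 : ((R : ℝ) ^ 3)⁻¹ ≤ m * ((R : ℝ) ^ (n + 1))⁻¹ := by
      rw [← div_eq_mul_inv, inv_eq_one_div, div_le_div_iff₀ (by positivity) (by positivity),
        pow_succ]
      calc 1 * ((R : ℝ) ^ n * R) ≤ 1 * (m * (R : ℝ) ^ 2 * R) := by gcongr
        _ = m * (R : ℝ) ^ 3 := by ring
    have h9 : (m : ℝ) * ((R : ℝ) ^ (n + 1))⁻¹ ≤ m * |x - y| := by gcongr
    linarith
  · push Not at hex
    exact ⟨0, fun j _ => hex j⟩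

/-- The denominators minimising the distance of `m * θ` to the integers over `1 ≤ m ≤ R ^ i`. -/
theorem exists_best_denominators (θ : ℝ) {R : ℕ} (hR : 1 ≤ R) :
    ∃ M : ℕ → ℕ, ∀ i, 1 ≤ M i ∧ M i ≤ R ^ i ∧ normZ (M i * θ) ≤ ((R : ℝ) ^ i)⁻¹ ∧
      ∀ m, 1 ≤ m → m ≤ R ^ i → normZ (M i * θ) ≤ normZ (m * θ) := by
  refine Classical.axiomOfChoice (r := fun i m => 1 ≤ m ∧ m ≤ R ^ i ∧
    normZ (m * θ) ≤ ((R : ℝ) ^ i)⁻¹ ∧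
      ∀ k, 1 ≤ k → k ≤ R ^ i → normZ (m * θ) ≤ normZ (k * θ)) fun i => ?_
  have hpos : 0 < R ^ i := Nat.pow_pos hR
  obtain ⟨m, hm, hmin⟩ := Finset.exists_min_image (Finset.Icc 1 (R ^ i))
    (fun m : ℕ => normZ (m * θ)) ⟨1, Finset.mem_Icc.2 ⟨le_rfl, hpos⟩⟩
  rw [Finset.mem_Icc] at hm
  have hmin' : ∀ k, 1 ≤ k → k ≤ R ^ i → normZ (m * θ) ≤ normZ (k * θ) :=
    fun k h1 h2 => hmin k (Finset.mem_Icc.2 ⟨h1, h2⟩)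
  refine ⟨m, hm.1, hm.2, ?_, hmin'⟩
  obtain ⟨k, hk0, hk, hkθ⟩ := Real.exists_nat_abs_mul_sub_round_le θ hpos
  refine (hmin' k hk0 hk).trans ?_
  rw [normZ_eq_abs_sub_round]
  refine hkθ.trans ?_
  have : (0 : ℝ) < (R : ℝ) ^ i := by exact_mod_cast hpos
  rw [← one_div]
  push_cast
  gcongr
  linarith

/-- If multiples of `x` by the best denominators of `θ` stay away from the integers, then
`x ∈ Bad⁺_θ`. -/
theorem mem_badPlus_of_le_normZ {θ x : ℝ} {R : ℕ} (hR : 4 ≤ R) {M : ℕ → ℕ}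
    (hM : ∀ i, 1 ≤ M i ∧ M i ≤ R ^ i ∧ normZ (M i * θ) ≤ ((R : ℝ) ^ i)⁻¹ ∧
      ∀ m, 1 ≤ m → m ≤ R ^ i → normZ (M i * θ) ≤ normZ (m * θ))
    (hx : ∀ i, R ^ i ≤ M i * R → (2 * (R : ℝ) ^ 3)⁻¹ ≤ normZ (M i * x)) :
    x ∈ BadPlus θ := by
  have hR' : (4 : ℝ) ≤ R := by exact_mod_cast hR
  refine ⟨(4 * (R : ℝ) ^ 8)⁻¹, by positivity, fun q hq => ?_⟩
  have hq' : (0 : ℝ) < q := by exact_mod_cast hq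
  set L := Nat.log R q with hL
  have hLq : (R : ℝ) ^ L ≤ q := by exact_mod_cast Nat.pow_log_le_self R (by omega)
  have hqL : (q : ℝ) < (R : ℝ) ^ (L + 1) := by
    exact_mod_cast Nat.lt_pow_succ_log_self (by omega) q
  have hex : ∃ i, normZ (M i * θ) ≤ normZ (M (L + 5) * θ) := ⟨_, le_rfl⟩
  classical
  obtain ⟨i, hi, hiM⟩ : ∃ i, normZ (M i * θ) ≤ normZ (M (L + 5) * θ) ∧
      (M i ≤ R ^ (L + 5) ∧ R ^ i ≤ M i * R) := by
    refine ⟨Nat.find hex, Nat.find_spec hex, ?_, ?_⟩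
    · exact (hM _).2.1.trans (Nat.pow_le_pow_right (by omega) (Nat.find_min' hex le_rfl))
    · rcases hk : Nat.find hex with _ | k
      · have := (hM 0).1
        rw [pow_zero]
        nlinarith
      · by_contra! hlt
        rw [pow_succ] at hlt
        have hlt' := Nat.lt_of_mul_lt_mul_right hlt
        have hspec := Nat.find_spec hex
        rw [hk] at hspec
        exact Nat.find_min hex (by omega : k < Nat.find hex)
          (((hM k).2.2.2 _ (hM (k + 1)).1 hlt'.le).trans hspec)
  have h1 := hx i hiM.2
  have h2 := normZ_natCast_mul_le q (M i) θ x
  have h3 : (q : ℝ) * normZ (M i * θ) ≤ (4 * (R : ℝ) ^ 3)⁻¹ := by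
    calc (q : ℝ) * normZ (M i * θ) ≤ (R : ℝ) ^ (L + 1) * ((R : ℝ) ^ (L + 5))⁻¹ :=
          mul_le_mul hqL.le (hi.trans (hM _).2.2.1) (normZ_nonneg _) (by positivity)
      _ = ((R : ℝ) * (R : ℝ) ^ 3)⁻¹ := by
          rw [show L + 5 = (L + 1) + 4 by ring, pow_add _ (L + 1)]
          field_simp
      _ ≤ _ := by gcongr
  have h4 : (2 * (R : ℝ) ^ 3)⁻¹ = (4 * (R : ℝ) ^ 3)⁻¹ + (4 * (R : ℝ) ^ 3)⁻¹ := by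
    field_simp
    norm_num
  have hnn := normZ_nonneg (θ * q - x)
  have h5 : (M i : ℝ) ≤ q * (R : ℝ) ^ 5 := by
    calc (M i : ℝ) ≤ (R : ℝ) ^ (L + 5) := by exact_mod_cast hiM.1
      _ = (R : ℝ) ^ L * (R : ℝ) ^ 5 := pow_add _ _ _
      _ ≤ _ := by gcongr
  have h6 : (4 * (R : ℝ) ^ 3)⁻¹ ≤ q * (R : ℝ) ^ 5 * normZ (θ * q - x) :=
    calc (4 * (R : ℝ) ^ 3)⁻¹ ≤ M i * normZ (θ * q - x) := by linarith
      _ ≤ _ := by gcongr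
  rw [ge_iff_le, div_le_iff₀ hq']
  calc (4 * (R : ℝ) ^ 8)⁻¹ = (4 * (R : ℝ) ^ 3)⁻¹ / (R : ℝ) ^ 5 := by
        field_simp
    _ ≤ q * (R : ℝ) ^ 5 * normZ (θ * q - x) / (R : ℝ) ^ 5 := by gcongr
    _ = normZ (θ * q - x) * q := by field_simp

theorem log_div_log_le_dimH_badPlus (θ : ℝ) {N : ℕ} (hN : 2 ≤ N) :
    ENNReal.ofReal (Real.log N / Real.log (2 * N + 2 : ℕ)) ≤ dimH (BadPlus θ) := by
  obtain ⟨M, hM⟩ := exists_best_denominators θ (R := 2 * N + 2) (by omega)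
  have hB : ∀ n a : ℕ, ∃ b : Fin (N + 1), ∀ j : Fin (N + 1), j ≠ b →
      ∀ x ∈ adicIcc (2 * N + 2) (n + 1) ((2 * N + 2) * a + 2 * j), ∀ i, n = i + 1 →
        (2 * N + 2) ^ i ≤ M i * (2 * N + 2) →
          (2 * ((2 * N + 2 : ℕ) : ℝ) ^ 3)⁻¹ ≤ normZ (M i * x) := by
    intro n a
    rcases n with _ | i
    · exact ⟨0, fun _ _ _ _ i hi => by omega⟩
    · by_cases hi : (2 * N + 2) ^ i ≤ M i * (2 * N + 2)
      · obtain ⟨b, hb⟩ := exists_discarded_digit (N := N) (n := i + 1) (a := a) (m := M i)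
          (by rw [pow_succ]; gcongr; exact (hM i).2.1)
          (by rw [pow_succ, pow_two, ← mul_assoc]; gcongr)
        refine ⟨b, fun j hj x hx k hk _ => ?_⟩
        obtain rfl : i = k := by omega
        exact hb j hj x hx
      · refine ⟨0, fun j hj x hx k hk hk' => ?_⟩
        obtain rfl : i = k := by omega
        exact absurd hk' hi
  choose B hB using hB
  refine le_dimH_of_cantor hN B fun x hx => mem_badPlus_of_le_normZ (by omega) hM fun i hi => ?_
  obtain ⟨a, j, hj, hxj⟩ := hx (i + 1)
  exact hB _ a j hj x hxj i rfl hi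

theorem tendsto_log_div_log_two_mul_add_two :
    Tendsto (fun N : ℕ => Real.log N / Real.log (2 * N + 2 : ℕ)) atTop (𝓝 1) := by
  have hlog : Tendsto (fun N : ℕ => Real.log N) atTop atTop :=
    Real.tendsto_log_atTop.comp tendsto_natCast_atTop_atTop
  have hlim : Tendsto (fun N : ℕ => 1 - Real.log 4 / (Real.log 4 + Real.log N)) atTop (𝓝 1) := by
    simpa using (tendsto_const_nhds (x := (1 : ℝ))).sub
      ((tendsto_atTop_add_const_left _ (Real.log 4) hlog).const_div_atTop (Real.log 4))
  refine tendsto_of_tendsto_of_tendsto_of_le_of_le' hlim tendsto_const_nhds ?_ ?_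
  · filter_upwards [eventually_ge_atTop 2] with N hN
    have hN' : (2 : ℝ) ≤ N := by exact_mod_cast hN
    have h4 : 0 < Real.log 4 := Real.log_pos (by norm_num)
    have hl : 0 < Real.log N := Real.log_pos (by linarith)
    have heq : 1 - Real.log 4 / (Real.log 4 + Real.log N)
        = Real.log N / (Real.log 4 + Real.log N) := by
      field_simp
      ring
    rw [heq, ← Real.log_mul (by norm_num) (by linarith)]
    have : 0 < Real.log (2 * N + 2 : ℕ) := Real.log_pos (by push_cast; linarith)
    gcongr
    push_cast
    linarith
  · filter_upwards [eventually_ge_atTop 2] with N hN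
    have hN' : (2 : ℝ) ≤ N := by exact_mod_cast hN
    refine div_le_one_of_le₀ ?_ (Real.log_natCast_nonneg _)
    gcongr
    omega

/-- For any real number `θ`, `Bad⁺_θ` has Hausdorff dimension `1`. -/
theorem badPlus_dimH_eq_one (θ : ℝ) : dimH (BadPlus θ) = 1 := by
  refine le_antisymm ((dimH_mono (Set.subset_univ _)).trans_eq Real.dimH_univ) ?_
  have h := ENNReal.tendsto_ofReal tendsto_log_div_log_two_mul_add_two
  rw [ENNReal.ofReal_one] at h
  refine le_of_tendsto h ?_
  filter_upwards [eventually_ge_atTop 2] with N hN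
  exact log_div_log_le_dimH_badPlus θ hN
end
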